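/- Let 0 < ε < 1 and let K be a convex body in ℝⁿ with V(K) = V(B) and 𝓔_{-1}(K)/(n V(B)) ≥ 1 − ε. Let s_{-2}(u) := s_K(u) − e_{-2}(K)·u be the support function of K − e_{-2}(K), and set r := (∫_{S^{n-1}} dθ)^{1/2} / (∫_{S^{n-1}} s_{-2}(u)^{-2} dθ)^{1/2}. Then ∫_{S^{n-1}} (s_{-2}(u) − r)² dθ ≤ 2 n V(B) D(K)² ε. -/

import Mathlib

open MeasureTheory Metric Real Set
open scoped Pointwise RealInnerProductSpace

noncomputable section

/-- The surface measure `dθ` on the unit sphere `S^{n-1}` of `ℝⁿ`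
(its total mass is `n·V(B)`). -/
def sphMeasure (n : ℕ) : Measure (Metric.sphere (0 : EuclideanSpace ℝ (Fin n)) 1) :=
  (volume : Measure (EuclideanSpace ℝ (Fin n))).toSphere

/-- `K` is a convex body: compact, convex, with nonempty interior. -/
def IsConvexBody {n : ℕ} (K : Set (EuclideanSpace ℝ (Fin n))) : Prop :=
  IsCompact K ∧ Convex ℝ K ∧ (interior K).Nonempty

/-- The support function of `K`: `s_K(u) = max_{x ∈ K} x·u`. -/
def supp {n : ℕ} (K : Set (EuclideanSpace ℝ (Fin n))) (u : EuclideanSpace ℝ (Fin n)) : ℝ :=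
  sSup ((fun x => ⟪x, u⟫) '' K)

/-- `n`-dimensional Lebesgue measure (volume), as a real number. -/
def vol {n : ℕ} (K : Set (EuclideanSpace ℝ (Fin n))) : ℝ :=
  (volume K).toReal

/-- The closed unit ball `B` of `ℝⁿ`. -/
def unitBall (n : ℕ) : Set (EuclideanSpace ℝ (Fin n)) :=
  Metric.closedBall 0 1

/-- The entropy functional `𝓔(K) = sup_{x ∈ int K} ∫_{S^{n-1}} log (s_K(u) - x·u) dθ`. -/
def entropy {n : ℕ} (K : Set (EuclideanSpace ℝ (Fin n))) : ℝ :=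
  sSup ((fun x => ∫ u, Real.log (supp K u - ⟪x, (u : EuclideanSpace ℝ (Fin n))⟫)
      ∂(sphMeasure n)) '' interior K)

/-- The `p`-entropy functional `𝓔_p(K) = inf_{x ∈ int K} ∫_{S^{n-1}} (s_K(u) - x·u)^p dθ`. -/
def entropyP {n : ℕ} (p : ℝ) (K : Set (EuclideanSpace ℝ (Fin n))) : ℝ :=
  sInf ((fun x => ∫ u, (supp K u - ⟪x, (u : EuclideanSpace ℝ (Fin n))⟫) ^ p
      ∂(sphMeasure n)) '' interior K)

/-- The Hausdorff distance between convex bodies,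
`δ_H(K,L) = sup_{u ∈ S^{n-1}} |s_K(u) - s_L(u)|`. -/
def hdist {n : ℕ} (K L : Set (EuclideanSpace ℝ (Fin n))) : ℝ :=
  ⨆ u : Metric.sphere (0 : EuclideanSpace ℝ (Fin n)) 1, |supp K u - supp L u|

/-- The radius `r = (∫_{S^{n-1}} dθ)^{1/2} / (∫_{S^{n-1}} (s_K(u) - e·u)^{-2} dθ)^{1/2}`. -/
def rConst {n : ℕ} (K : Set (EuclideanSpace ℝ (Fin n))) (e : EuclideanSpace ℝ (Fin n)) : ℝ :=
  ((sphMeasure n) Set.univ).toReal ^ ((1 : ℝ) / 2) /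
    (∫ u, (supp K u - ⟪e, (u : EuclideanSpace ℝ (Fin n))⟫) ^ (-2 : ℝ) ∂(sphMeasure n))
      ^ ((1 : ℝ) / 2)


open scoped ENNReal


lemma bm1_compact (A B C : Set ℝ) (hA : IsCompact A) (hB : IsCompact B)
    (neA : A.Nonempty) (neB : B.Nonempty)
    (hC : ∀ a ∈ A, ∀ b ∈ B, (a + b) / 2 ∈ C) :
    volume A + volume B ≤ 2 * volume C := by
  obtain ⟨a0, ha0, hamax⟩ := hA.exists_isGreatest neA
  obtain ⟨b0, hb0, hbmin⟩ := hB.exists_isLeast neB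
  have h2 : volume ((fun x : ℝ => (2⁻¹ : ℝ) • x) ⁻¹' C) = 2 * volume C := by
    have := Measure.addHaar_preimage_smul (volume : Measure ℝ) (r := (2⁻¹ : ℝ)) (by norm_num) C
    simpa using this
  rw [← h2]
  have hA' : volume ((fun x => x + (-b0)) ⁻¹' A) = volume A := measure_preimage_add_right _ _ _
  have hB' : volume ((fun x => x + (-a0)) ⁻¹' B) = volume B := measure_preimage_add_right _ _ _
  rw [← hA', ← hB']
  have hmeas : MeasurableSet ((fun x => x + (-a0)) ⁻¹' B) :=
    (measurable_id.add_const _) hB.measurableSet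
  rw [← measure_union₀ hmeas.nullMeasurableSet]
  · apply measure_mono
    rintro x (hx | hx)
    · have := hC _ hx _ hb0
      simp only [mem_preimage, smul_eq_mul]
      convert this using 1; ring
    · have := hC _ ha0 _ hx
      simp only [mem_preimage, smul_eq_mul]
      convert this using 1; ring
  · refine measure_mono_null (t := {a0 + b0}) ?_ (by simp)
    rintro x ⟨h1, h2⟩
    have h1 := hamax h1
    have h2 := hbmin h2
    simp only [mem_singleton_iff]
    linarith

lemma bm1 (A B C : Set ℝ) (hA : MeasurableSet A) (hB : MeasurableSet B)
    (neA : A.Nonempty) (neB : B.Nonempty)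
    (hC : ∀ a ∈ A, ∀ b ∈ B, (a + b) / 2 ∈ C) :
    volume A + volume B ≤ 2 * volume C := by
  obtain ⟨a, ha⟩ := neA
  obtain ⟨b, hb⟩ := neB
  refine ENNReal.le_of_forall_pos_le_add ?_ |>.trans le_rfl
  intro δ hδ hfin
  have key : ∀ r < volume A, ∀ s < volume B, r + s ≤ 2 * volume C := by
    intro r hr s hs
    obtain ⟨K, hKA, hK, hrK⟩ := hA.exists_lt_isCompact hr
    obtain ⟨M, hMB, hM, hsM⟩ := hB.exists_lt_isCompact hs
    calc r + s ≤ volume (insert a K) + volume (insert b M) := by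
          gcongr
          · exact hrK.le.trans (measure_mono (subset_insert _ _))
          · exact hsM.le.trans (measure_mono (subset_insert _ _))
      _ ≤ _ := by
          apply bm1_compact _ _ _ (hK.insert _) (hM.insert _) (insert_nonempty _ _) (insert_nonempty _ _)
          intro x hx y hy
          exact hC _ (insert_subset ha hKA hx) _ (insert_subset hb hMB hy)
  have key2 : ∀ s < volume B, volume A + s ≤ 2 * volume C := by
    intro s hs
    by_cases hA0 : volume A = 0
    · rw [hA0, zero_add]
      obtain ⟨M, hMB, hM, hsM⟩ := hB.exists_lt_isCompact hs
      have := bm1_compact {a} (insert b M) C isCompact_singleton (hM.insert _) (singleton_nonempty _) (insert_nonempty _ _)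
        (by
          intro x hx y hy
          exact hC _ (by rw [hx]; exact ha) _ (insert_subset hb hMB hy))
      calc s ≤ volume (insert b M) := hsM.le.trans (measure_mono (subset_insert _ _))
        _ ≤ volume {a} + volume (insert b M) := le_add_self
        _ ≤ _ := this
    · apply ENNReal.le_of_forall_nnreal_lt
      intro r hr
      by_cases hs' : (r : ℝ≥0∞) ≤ s
      · exact hs'.trans ((by simpa using key 0 (pos_iff_ne_zero.2 hA0) s hs))
      · push Not at hs'
        have : (r : ℝ≥0∞) - s < volume A := by
          apply ENNReal.sub_lt_of_lt_add hs'.le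
          exact hr
        have := key _ this s hs
        rwa [tsub_add_cancel_of_le hs'.le] at this
  refine le_trans ?_ le_self_add
  by_cases hB0 : volume B = 0
  · rw [hB0, add_zero]
    apply ENNReal.le_of_forall_nnreal_lt
    intro r hr
    obtain ⟨K, hKA, hK, hrK⟩ := hA.exists_lt_isCompact hr
    have := bm1_compact (insert a K) {b} C (hK.insert _) isCompact_singleton (insert_nonempty _ _) (singleton_nonempty _)
        (by
          intro x hx y hy
          exact hC _ (insert_subset ha hKA hx) _ (by rw [hy]; exact hb))
    exact (hrK.le.trans (measure_mono (subset_insert _ _))).trans (le_self_add.trans this)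
  · apply ENNReal.le_of_forall_nnreal_lt
    intro r hr
    by_cases hs' : (r : ℝ≥0∞) ≤ volume A
    · exact hs'.trans ((by simpa using key2 0 (pos_iff_ne_zero.2 hB0)))
    · push Not at hs'
      have : (r : ℝ≥0∞) - volume A < volume B := by
        apply ENNReal.sub_lt_of_lt_add hs'.le
        rw [add_comm]; exact hr
      have := key2 _ this
      rwa [add_tsub_cancel_of_le hs'.le] at this

lemma pl_norm (F G H : ℝ → ℝ) (hF : Measurable F) (hG : Measurable G) (hH : Measurable H)
    (F0 : ∀ x, 0 ≤ F x) (G0 : ∀ x, 0 ≤ G x) (H0 : ∀ x, 0 ≤ H x)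
    (F1 : IsLUB (range F) 1) (G1 : IsLUB (range G) 1)
    (h : ∀ a b, F a * G b ≤ H ((a + b) / 2) ^ 2) :
    (∫⁻ x, ENNReal.ofReal (F x)) + ∫⁻ x, ENNReal.ofReal (G x)
      ≤ 2 * ∫⁻ x, ENNReal.ofReal (H x) := by
  rw [lintegral_eq_lintegral_meas_lt _ (ae_of_all _ F0) hF.aemeasurable,
    lintegral_eq_lintegral_meas_lt _ (ae_of_all _ G0) hG.aemeasurable,
    lintegral_eq_lintegral_meas_lt _ (ae_of_all _ H0) hH.aemeasurable,
    ← lintegral_const_mul' _ _ (by simp), ← lintegral_add_left']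
  · apply setLIntegral_mono' measurableSet_Ioi
    intro t ht
    have ht : 0 < t := ht
    by_cases ht1 : t < 1
    · apply bm1 _ _ _ (measurableSet_lt measurable_const hF) (measurableSet_lt measurable_const hG)
      · obtain ⟨_, ⟨x, rfl⟩, hx⟩ := (lt_isLUB_iff F1).1 ht1
        exact ⟨x, hx⟩
      · obtain ⟨_, ⟨x, rfl⟩, hx⟩ := (lt_isLUB_iff G1).1 ht1
        exact ⟨x, hx⟩
      · intro a ha b hb
        simp only [mem_ofPred_eq] at *
        have := h a b
        by_contra hc
        push Not at hc
        nlinarith [H0 ((a+b)/2), F0 a, G0 b]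
    · have e1 : {a | t < F a} = ∅ := by
        ext x; simp only [mem_ofPred_eq, mem_empty_iff_false, iff_false]
        have : F x ≤ 1 := F1.1 ⟨x, rfl⟩
        linarith
      have e2 : {a | t < G a} = ∅ := by
        ext x; simp only [mem_ofPred_eq, mem_empty_iff_false, iff_false]
        have : G x ≤ 1 := G1.1 ⟨x, rfl⟩
        linarith
      rw [e1, e2]; simp
  · apply Measurable.aemeasurable
    apply Antitone.measurable
    intro s t hst
    apply measure_mono
    intro x hx
    simp only [mem_ofPred_eq] at *
    linarith

lemma ennreal_amgm (x y z : ℝ≥0∞) (h : x + y ≤ 2 * z) : x * y ≤ z ^ 2 := by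
  by_cases hz : z = ⊤
  · simp [hz]
  have hs : x + y ≠ ⊤ := ne_top_of_le_ne_top (ENNReal.mul_ne_top (by simp) hz) h
  have hx : x ≠ ⊤ := fun h => hs (by simp [h])
  have hy : y ≠ ⊤ := fun h => hs (by simp [h])
  lift x to NNReal using hx
  lift y to NNReal using hy
  lift z to NNReal using hz
  norm_cast at *
  rw [← NNReal.coe_le_coe] at *
  push_cast at *
  nlinarith [sq_nonneg ((x:ℝ) - y), x.2, y.2, z.2]

lemma pl_bdd (F G H : ℝ → ℝ) (hF : Measurable F) (hG : Measurable G) (hH : Measurable H)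
    (F0 : ∀ x, 0 ≤ F x) (G0 : ∀ x, 0 ≤ G x) (H0 : ∀ x, 0 ≤ H x)
    (M : ℝ) (F1 : ∀ x, F x ≤ M) (G1 : ∀ x, G x ≤ M)
    (h : ∀ a b, F a * G b ≤ H ((a + b) / 2) ^ 2) :
    (∫⁻ x, ENNReal.ofReal (F x)) * ∫⁻ x, ENNReal.ofReal (G x)
      ≤ (∫⁻ x, ENNReal.ofReal (H x)) ^ 2 := by
  by_cases hFz : ∀ x, F x = 0
  · simp [hFz]
  by_cases hGz : ∀ x, G x = 0
  · simp [hGz]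
  push Not at hFz hGz
  obtain ⟨x0, hx0⟩ := hFz
  obtain ⟨y0, hy0⟩ := hGz
  obtain ⟨α, hα⟩ : ∃ α, IsLUB (range F) α :=
    ⟨_, isLUB_csSup (range_nonempty _) ⟨M, by rintro _ ⟨x, rfl⟩; exact F1 x⟩⟩
  obtain ⟨β, hβ⟩ : ∃ α, IsLUB (range G) α :=
    ⟨_, isLUB_csSup (range_nonempty _) ⟨M, by rintro _ ⟨x, rfl⟩; exact G1 x⟩⟩
  have α0 : 0 < α := lt_of_lt_of_le (lt_of_le_of_ne (F0 x0) (Ne.symm hx0)) (hα.1 ⟨x0, rfl⟩)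
  have β0 : 0 < β := lt_of_lt_of_le (lt_of_le_of_ne (G0 y0) (Ne.symm hy0)) (hβ.1 ⟨y0, rfl⟩)
  have lub : ∀ (F : ℝ → ℝ) (α : ℝ), 0 < α → IsLUB (range F) α →
      IsLUB (range fun x => α⁻¹ * F x) 1 := by
    intro F α α0 hα
    constructor
    · rintro _ ⟨x, rfl⟩
      have : F x ≤ α := hα.1 ⟨x, rfl⟩
      simp only
      rw [inv_mul_le_iff₀ α0]; simpa
    · intro b hb
      have : α ≤ α * b := hα.2 (by
        rintro _ ⟨x, rfl⟩
        have := hb ⟨x, rfl⟩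
        simp only at this
        rwa [inv_mul_le_iff₀ α0] at this)
      nlinarith
  have key := pl_norm (fun x => α⁻¹ * F x) (fun x => β⁻¹ * G x) (fun x => (√(α * β))⁻¹ * H x)
    (by fun_prop) (by fun_prop) (by fun_prop)
    (fun x => mul_nonneg (by positivity) (F0 x)) (fun x => mul_nonneg (by positivity) (G0 x))
    (fun x => mul_nonneg (by positivity) (H0 x)) (lub F α α0 hα) (lub G β β0 hβ)
    (by
      intro a b
      rw [mul_pow, inv_pow, Real.sq_sqrt (by positivity)]
      calc α⁻¹ * F a * (β⁻¹ * G b) = (α * β)⁻¹ * (F a * G b) := by field_simp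
        _ ≤ _ := by gcongr; exact h a b)
  have key2 := ennreal_amgm _ _ _ key
  have i1 : ∀ (c : ℝ), 0 ≤ c → ∀ F : ℝ → ℝ, (∫⁻ x, ENNReal.ofReal (c * F x)) =
      ENNReal.ofReal c * ∫⁻ x, ENNReal.ofReal (F x) := by
    intro c hc F
    rw [← lintegral_const_mul' _ _ (by simp)]
    simp_rw [ENNReal.ofReal_mul hc]
  rw [i1 _ (by positivity), i1 _ (by positivity), i1 _ (by positivity), mul_pow,
    ← ENNReal.ofReal_pow (by positivity), inv_pow, Real.sq_sqrt (by positivity)] at key2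
  set X := ∫⁻ x, ENNReal.ofReal (F x)
  set Y := ∫⁻ x, ENNReal.ofReal (G x)
  set Z := ∫⁻ x, ENNReal.ofReal (H x)
  have e : ENNReal.ofReal α⁻¹ * X * (ENNReal.ofReal β⁻¹ * Y) = ENNReal.ofReal (α * β)⁻¹ * (X * Y) := by
    rw [mul_inv, ENNReal.ofReal_mul (by positivity)]; ring
  rw [e] at key2
  rwa [ENNReal.mul_le_mul_iff_right] at key2
  · exact (ENNReal.ofReal_pos.2 (by positivity)).ne'
  · simp

lemma pl (F G : ℝ → ℝ≥0∞) (H : ℝ → ℝ) (hF : Measurable F) (hG : Measurable G) (hH : Measurable H)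
    (H0 : ∀ x, 0 ≤ H x)
    (h : ∀ a b, F a * G b ≤ ENNReal.ofReal (H ((a + b) / 2) ^ 2)) :
    (∫⁻ x, F x) * ∫⁻ x, G x ≤ (∫⁻ x, ENNReal.ofReal (H x)) ^ 2 := by
  have hsup : ∀ F : ℝ → ℝ≥0∞, Measurable F → ∫⁻ x, F x = ⨆ k : ℕ, ∫⁻ x, min (F x) k := by
    intro F hF
    rw [← lintegral_iSup (fun k => by fun_prop)]
    · congr 1; ext x
      apply le_antisymm
      · by_cases hx : F x = ⊤
        · simp [hx, ENNReal.iSup_natCast]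
        · obtain ⟨k, hk⟩ := ENNReal.exists_nat_gt hx
          refine le_iSup_of_le k ?_
          rw [min_eq_left hk.le]
      · exact iSup_le fun k => min_le_left _ _
    · intro i j hij x
      simp only
      gcongr
  rw [hsup F hF, hsup G hG, ENNReal.iSup_mul]
  refine iSup_le fun k => ?_
  rw [ENNReal.mul_iSup]
  refine iSup_le fun l => ?_
  have fin : ∀ (x : ℝ≥0∞) (k : ℕ), min x k ≠ ⊤ := fun x k =>
    ne_top_of_le_ne_top (ENNReal.natCast_ne_top k) (min_le_right _ _)
  have := pl_bdd (fun x => (min (F x) k).toReal) (fun x => (min (G x) l).toReal) H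
    (by fun_prop) (by fun_prop) hH (fun _ => ENNReal.toReal_nonneg) (fun _ => ENNReal.toReal_nonneg) H0
    (max k l)
    (fun x => by
      refine le_trans ?_ (le_max_left _ _)
      have := ENNReal.toReal_mono (ENNReal.natCast_ne_top k) (min_le_right (F x) (k : ℝ≥0∞))
      simpa using this)
    (fun x => by
      refine le_trans ?_ (le_max_right _ _)
      have := ENNReal.toReal_mono (ENNReal.natCast_ne_top l) (min_le_right (G x) (l : ℝ≥0∞))
      simpa using this)
    (by
      intro a b
      rw [← ENNReal.toReal_mul]
      apply ENNReal.toReal_le_of_le_ofReal (by positivity)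
      refine le_trans ?_ (h a b)
      gcongr
      · exact min_le_left _ _
      · exact min_le_left _ _)
  simpa only [ENNReal.ofReal_toReal (fin _ _)] using this

lemma lintegral_exp_subst (f : ℝ → ℝ≥0∞) :
    ∫⁻ s in Ioi (0:ℝ), f s = ∫⁻ a, ENNReal.ofReal (rexp a) * f (rexp a) := by
  have := lintegral_image_eq_lintegral_abs_deriv_mul (s := univ) (f := rexp) (f' := rexp)
    MeasurableSet.univ (fun x _ => (Real.hasDerivAt_exp x).hasDerivWithinAt)
    Real.exp_injective.injOn f
  rw [image_univ, Real.range_exp, setLIntegral_univ] at this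
  rw [this]
  simp only [abs_of_pos (Real.exp_pos _)]

lemma half_line (f g : ℝ → ℝ≥0∞) (hf : Measurable f) (hg : Measurable g) (c : ℝ) (hc : 0 ≤ c)
    (h : ∀ s > 0, ∀ t > 0, f s * g t ≤ ENNReal.ofReal (c * rexp (-(s * t)))) :
    (∫⁻ s in Ioi (0:ℝ), f s) * (∫⁻ s in Ioi (0:ℝ), g s) ≤ ENNReal.ofReal (c * (π / 2)) := by
  rw [lintegral_exp_subst f, lintegral_exp_subst g]
  refine (pl _ _ (fun a => rexp a * (√c * rexp (-(1/2) * (rexp a)^2))) (by fun_prop) (by fun_prop) (by fun_prop)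
    (fun x => by positivity) ?_).trans ?_
  · intro a b
    calc ENNReal.ofReal (rexp a) * f (rexp a) * (ENNReal.ofReal (rexp b) * g (rexp b))
        = ENNReal.ofReal (rexp a) * ENNReal.ofReal (rexp b) * (f (rexp a) * g (rexp b)) := by ring
      _ ≤ ENNReal.ofReal (rexp a) * ENNReal.ofReal (rexp b) * ENNReal.ofReal (c * rexp (-(rexp a * rexp b))) := by
          gcongr; exact h _ (exp_pos _) _ (exp_pos _)
      _ = _ := by
          rw [← ENNReal.ofReal_mul (by positivity), ← ENNReal.ofReal_mul (by positivity)]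
          congr 1
          rw [mul_pow, mul_pow, Real.sq_sqrt hc, ← Real.exp_nat_mul, ← Real.exp_nat_mul]
          have e : rexp (((2:ℕ):ℝ) * ((a + b) / 2)) = rexp a * rexp b := by
            rw [← Real.exp_add]; push_cast; ring_nf
          rw [e]
          push_cast
          ring_nf
  · simp_rw [ENNReal.ofReal_mul (exp_pos _).le]
    rw [← lintegral_exp_subst (fun s => ENNReal.ofReal (√c * rexp (-(1/2) * s^2))),
      ← ofReal_integral_eq_lintegral_ofReal]
    · rw [integral_const_mul, integral_gaussian_Ioi, ← ENNReal.ofReal_pow (by positivity)]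
      apply ENNReal.ofReal_le_ofReal
      rw [mul_pow, Real.sq_sqrt hc, div_pow, Real.sq_sqrt (by positivity)]
      apply le_of_eq; ring
    · exact ((integrable_exp_neg_mul_sq (by norm_num)).const_mul _).integrableOn
    · exact ae_of_all _ fun x => by positivity

/-- Gaussian functional Santalo inequality for centered `f`. -/
def SProp {X : Type*} [MeasurableSpace X] (μ : Measure X) (p : X → X → ℝ) (C : ℝ) : Prop :=
  ∀ (f : X → ℝ) (g : X → ℝ≥0∞), Measurable f → Measurable g → (∀ x, 0 ≤ f x) →
    Integrable f μ → (∀ w, Integrable (fun x => f x * p x w) μ ∧ ∫ x, f x * p x w ∂μ = 0) →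
    (∀ x y, ENNReal.ofReal (f x) * g y ≤ ENNReal.ofReal (rexp (-p x y))) →
    (∫⁻ x, ENNReal.ofReal (f x) ∂μ) * ∫⁻ x, g x ∂μ ≤ ENNReal.ofReal C

section
variable {E : Type*} [NormedAddCommGroup E] [InnerProductSpace ℝ E] [FiniteDimensional ℝ E]
  [MeasurableSpace E] [BorelSpace E]

lemma half_space {C : ℝ} (hC : 0 ≤ C)
    (hS : SProp (volume : Measure E) (fun x y => ⟪x, y⟫) C)
    (φ : ℝ × E → ℝ) (ψ : ℝ × E → ℝ≥0∞) (hφ : Measurable φ) (hψ : Measurable ψ)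
    (φ0 : ∀ x, 0 ≤ φ x)
    (hi : Integrable φ ((volume.restrict (Ioi (0:ℝ))).prod volume))
    (hm : ∀ w : E, Integrable (fun q => φ q * ⟪q.2, w⟫) ((volume.restrict (Ioi (0:ℝ))).prod volume) ∧
      ∫ q, φ q * ⟪q.2, w⟫ ∂((volume.restrict (Ioi (0:ℝ))).prod volume) = 0)
    (h : ∀ s > 0, ∀ t > 0, ∀ y w, ENNReal.ofReal (φ (s, y)) * ψ (t, w) ≤
      ENNReal.ofReal (rexp (-(s * t + ⟪y, w⟫)))) :
    (∫⁻ q, ENNReal.ofReal (φ q) ∂((volume.restrict (Ioi (0:ℝ))).prod volume)) *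
      ∫⁻ q, ψ q ∂((volume.restrict (Ioi (0:ℝ))).prod volume) ≤ ENNReal.ofReal (π / 2 * C) := by
  set ν := volume.restrict (Ioi (0:ℝ)) with hν
  set F : E → ℝ := fun y => ∫ s, φ (s, y) ∂ν with hF
  set G : E → ℝ≥0∞ := fun w => ∫⁻ s, ψ (s, w) ∂ν with hG
  have mF : Measurable F := hφ.stronglyMeasurable.integral_prod_left'.measurable
  have mG : Measurable G := hψ.lintegral_prod_left'
  have F0 : ∀ y, 0 ≤ F y := fun y => integral_nonneg fun s => φ0 _
  have iF : Integrable F := hi.integral_prod_right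
  have key := hS F (fun w => ENNReal.ofReal (2 / π) * G w) mF (mG.const_mul _) F0 iF ?_ ?_
  · have e1 : ∫⁻ x, ENNReal.ofReal (F x) = ∫⁻ q, ENNReal.ofReal (φ q) ∂(ν.prod volume) := by
      rw [← ofReal_integral_eq_lintegral_ofReal iF (ae_of_all _ F0),
        ← ofReal_integral_eq_lintegral_ofReal hi (ae_of_all _ φ0), integral_prod_symm _ hi]
    have e2 : ∫⁻ x, G x = ∫⁻ q, ψ q ∂(ν.prod volume) := by
      rw [lintegral_prod_symm' _ hψ]
    rw [lintegral_const_mul _ mG, e1, e2] at key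
    have e3 : ENNReal.ofReal (π / 2) * ENNReal.ofReal (2 / π) = 1 := by
      rw [← ENNReal.ofReal_mul (by positivity)]
      have : π / 2 * (2 / π) = 1 := by field_simp
      simp [this]
    rw [ENNReal.ofReal_mul (by positivity)]
    calc _ = ENNReal.ofReal (π / 2) * ENNReal.ofReal (2 / π) * ((∫⁻ q, ENNReal.ofReal (φ q) ∂(ν.prod volume)) *
      ∫⁻ q, ψ q ∂(ν.prod volume)) := by rw [e3, one_mul]
      _ = ENNReal.ofReal (π / 2) * ((∫⁻ q, ENNReal.ofReal (φ q) ∂(ν.prod volume)) *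
       (ENNReal.ofReal (2 / π) * ∫⁻ q, ψ q ∂(ν.prod volume))) := by ring
      _ ≤ _ := by gcongr
  · intro w
    obtain ⟨h1, h2⟩ := hm w
    have e : (fun x => F x * ⟪x, w⟫) = fun x => ∫ s, φ (s, x) * ⟪x, w⟫ ∂ν := by
      ext x; rw [integral_mul_const]
    simp only [e]
    refine ⟨h1.integral_prod_right, ?_⟩
    rw [← h2, integral_prod_symm _ h1]
  · intro y w
    have h1 : ENNReal.ofReal (F y) ≤ ∫⁻ s, ENNReal.ofReal (φ (s, y)) ∂ν := by
      simp only [hF]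
      rw [integral_eq_lintegral_of_nonneg_ae (ae_of_all _ fun s => φ0 _)
        (hφ.comp (by fun_prop)).aestronglyMeasurable]
      exact ENNReal.ofReal_toReal_le
    have h2 := half_line (fun s => ENNReal.ofReal (φ (s, y))) (fun s => ψ (s, w))
      (hφ.comp (by fun_prop)).ennreal_ofReal (hψ.comp (by fun_prop)) (rexp (-⟪y, w⟫)) (exp_pos _).le
      (by
        intro s hs t ht
        refine (h s hs t ht y w).trans (le_of_eq ?_)
        rw [← Real.exp_add]; ring_nf)
    calc ENNReal.ofReal (F y) * (ENNReal.ofReal (2 / π) * G w)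
        ≤ (∫⁻ s, ENNReal.ofReal (φ (s, y)) ∂ν) * (ENNReal.ofReal (2 / π) * G w) := by gcongr
      _ = ENNReal.ofReal (2 / π) * ((∫⁻ s, ENNReal.ofReal (φ (s, y)) ∂ν) * G w) := by ring
      _ ≤ ENNReal.ofReal (2 / π) * ENNReal.ofReal (rexp (-⟪y, w⟫) * (π / 2)) := by gcongr
      _ = _ := by
        rw [← ENNReal.ofReal_mul (by positivity)]; congr 1; field_simp

lemma half_case {C : ℝ} (hC : 0 ≤ C)
    (hS : SProp (volume : Measure E) (fun x y => ⟪x, y⟫) C)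
    (φ : ℝ × E → ℝ) (ψ : ℝ × E → ℝ≥0∞) (hφ : Measurable φ) (hψ : Measurable ψ)
    (φ0 : ∀ x, 0 ≤ φ x) (A : Set ℝ) (t σ : ℝ) (hσ : σ * σ = 1) (z v : E)
    (hA : MeasurePreserving (fun s => t + σ * s) (volume.restrict (Ioi (0:ℝ))) (volume.restrict A))
    (hi : Integrable φ ((volume.restrict A).prod volume))
    (hi1 : Integrable (fun q => φ q * (q.1 - t)) ((volume.restrict A).prod volume))
    (hi2 : ∀ w, Integrable (fun q => φ q * ⟪q.2, w⟫) ((volume.restrict A).prod volume))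
    (hm : ∀ w : E, ∫ q, φ q * ⟪q.2, w⟫ ∂((volume.restrict A).prod volume) -
      ⟪z, w⟫ * (∫ q, φ q ∂((volume.restrict A).prod volume)) -
      ⟪v, w⟫ * (∫ q, φ q * (q.1 - t) ∂((volume.restrict A).prod volume)) = 0)
    (h : ∀ x y : ℝ × E, ENNReal.ofReal (φ ((t, z) + x)) * ψ y ≤
      ENNReal.ofReal (rexp (-(x.1 * y.1 + ⟪x.2, y.2⟫)))) :
    (∫⁻ q, ENNReal.ofReal (φ q) ∂((volume.restrict A).prod volume)) *
      ∫⁻ q : ℝ × E, ψ (σ * q.1 - ⟪v, q.2⟫, q.2) ∂((volume.restrict (Ioi (0:ℝ))).prod volume)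
        ≤ ENNReal.ofReal (π / 2 * C) := by
  set Θ : ℝ × E → ℝ × E := fun q => (t + σ * q.1, (z + (σ * q.1) • v) + q.2) with hΘ
  have mp : MeasurePreserving Θ ((volume.restrict (Ioi (0:ℝ))).prod volume)
      ((volume.restrict A).prod volume) := by
    refine hA.skew_product (g := fun s y => (z + (σ * s) • v) + y) (by fun_prop) ?_
    exact ae_of_all _ fun s => map_add_left_eq_self _ _
  have mΘ := mp.measurable
  rw [← mp.lintegral_comp hφ.ennreal_ofReal]
  have cI : ∀ {f : ℝ × E → ℝ}, Integrable f ((volume.restrict A).prod volume) →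
      Integrable (fun q => f (Θ q)) ((volume.restrict (Ioi (0:ℝ))).prod volume) := by
    intro f hf
    exact mp.integrable_comp_of_integrable hf
  have cV : ∀ {f : ℝ × E → ℝ}, Integrable f ((volume.restrict A).prod volume) →
      ∫ q, f (Θ q) ∂((volume.restrict (Ioi (0:ℝ))).prod volume) =
      ∫ q, f q ∂((volume.restrict A).prod volume) := by
    intro f hf
    rw [← mp.map_eq] at hf ⊢
    exact (integral_map mΘ.aemeasurable hf.1).symm
  refine half_space hC hS (fun q => φ (Θ q)) _ (hφ.comp mΘ) (hψ.comp (by fun_prop)) (fun x => φ0 _)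
    (cI hi) ?_ ?_
  · intro w
    have I : Integrable (fun q => φ q * ⟪q.2, w⟫ - ⟪z, w⟫ * φ q - ⟪v, w⟫ * (φ q * (q.1 - t)))
      ((volume.restrict A).prod volume) := ((hi2 w).sub (hi.const_mul _)).sub (hi1.const_mul _)
    have e : (fun q : ℝ × E => φ (Θ q) * ⟪q.2, w⟫) = fun q => (fun q => φ q * ⟪q.2, w⟫ - ⟪z, w⟫ * φ q - ⟪v, w⟫ * (φ q * (q.1 - t))) (Θ q) := by
      ext q
      simp only [hΘ, inner_add_left, inner_smul_left]
      simp
      ring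
    rw [e]
    refine ⟨cI I, ?_⟩
    rw [cV I, integral_sub, integral_sub, integral_const_mul, integral_const_mul, hm w]
    · exact hi2 w
    · exact hi.const_mul _
    · exact (hi2 w).sub (hi.const_mul _)
    · exact hi1.const_mul _
  · intro s hs s' hs' y w
    have := h (σ * s, (σ * s) • v + y) (σ * s' - ⟪v, w⟫, w)
    simp only [hΘ]
    simp only [Prod.mk_add_mk, ← add_assoc] at this
    refine this.trans (le_of_eq ?_)
    congr 3
    simp only [inner_add_left, inner_smul_left]
    simp
    linear_combination s * s' * hσ

lemma lint_split (ψ : ℝ × E → ℝ≥0∞) (hψ : Measurable ψ) (v : E) :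
    (∫⁻ q : ℝ × E, ψ (1 * q.1 - ⟪v, q.2⟫, q.2) ∂((volume.restrict (Ioi (0:ℝ))).prod volume)) +
    (∫⁻ q : ℝ × E, ψ ((-1) * q.1 - ⟪v, q.2⟫, q.2) ∂((volume.restrict (Ioi (0:ℝ))).prod volume)) =
    ∫⁻ q, ψ q ∂((volume : Measure ℝ).prod volume) := by
  have m : ∀ σ : ℝ, Measurable (fun q : ℝ × E => ψ (σ * q.1 - ⟪v, q.2⟫, q.2)) := fun σ =>
    hψ.comp (by fun_prop)
  rw [lintegral_prod_symm' _ (m 1), lintegral_prod_symm' _ (m (-1)), lintegral_prod_symm' _ hψ,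
    ← lintegral_add_left (m 1).lintegral_prod_left']
  congr 1; ext w
  simp only [one_mul, neg_one_mul]
  have e : ∫⁻ s in Ioi (0:ℝ), ψ (-s - ⟪v, w⟫, w) = ∫⁻ s in Iic (0:ℝ), ψ (s - ⟪v, w⟫, w) := by
    have mp : MeasurePreserving (fun s : ℝ => -s) (volume.restrict (Ioi 0)) (volume.restrict (Iio 0)) := by
      have := (Measure.measurePreserving_neg (volume : Measure ℝ)).restrict_preimage (s := Iio 0) measurableSet_Iio
      simpa using this
    rw [Measure.restrict_congr_set (Iio_ae_eq_Iic (α := ℝ)).symm]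
    have mm : Measurable fun s : ℝ => ψ (s - ⟪v, w⟫, w) := hψ.comp (by fun_prop)
    exact mp.lintegral_comp mm
  rw [e, add_comm, ← compl_Iic, lintegral_add_compl _ measurableSet_Iic]
  exact lintegral_sub_right_eq_self (fun s => ψ (s, w)) ⟪v, w⟫

end

section
variable {E : Type*} [NormedAddCommGroup E] [InnerProductSpace ℝ E] [FiniteDimensional ℝ E]
  [MeasurableSpace E] [BorelSpace E]

lemma bddsupp_integrable {F : Type*} [NormedAddCommGroup F] [NormedSpace ℝ F] [SecondCountableTopology F]
    [MeasurableSpace F] [BorelSpace F]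
    (φ : ℝ × E → ℝ) (hφ : Measurable φ)
    (φ0 : ∀ x, 0 ≤ φ x) (M R : ℝ) (hM : ∀ x, φ x ≤ M) (hR : ∀ x, R < ‖x‖ → φ x = 0)
    (h : ℝ × E → F) (hh : Continuous h) :
    Integrable (fun q => φ q • h q) ((volume : Measure ℝ).prod (volume : Measure E)) := by
  obtain ⟨N, hN⟩ := (isCompact_closedBall (0 : ℝ × E) R).exists_bound_of_continuousOn hh.continuousOn
  rw [← integrableOn_iff_integrable_of_support_subset (s := closedBall 0 R)]
  · apply Measure.integrableOn_of_bounded (M := M * N)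
    · rw [← Measure.volume_eq_prod]; exact measure_closedBall_lt_top.ne
    · exact (hφ.aestronglyMeasurable).smul hh.aestronglyMeasurable
    · filter_upwards [ae_restrict_mem measurableSet_closedBall] with x hx
      rw [norm_smul, Real.norm_of_nonneg (φ0 x)]
      exact mul_le_mul (hM x) (hN x hx) (norm_nonneg _) ((φ0 x).trans (hM x))
  · intro x hx
    by_contra hc
    simp only [mem_closedBall, dist_zero_right, not_le] at hc
    simp [hR x hc] at hx

lemma median_exists (m : ℝ → ℝ) (hm : Integrable m) (R : ℝ) (hR0 : 0 ≤ R) (hR : ∀ x, R < |x| → m x = 0) :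
    ∃ t, ∫ x in Iio t, m x = (∫ x, m x) / 2 ∧ ∫ x in Ioi t, m x = (∫ x, m x) / 2 := by
  set I := ∫ x, m x with hI
  have e1 : ∫ x in Iic (-R-1), m x = 0 := by
    apply setIntegral_eq_zero_of_forall_eq_zero
    intro x hx
    apply hR
    have : x ≤ -R-1 := hx
    rw [abs_of_neg (by linarith)]; linarith
  have e2 : ∫ x in Ioi (R+1), m x = 0 := by
    apply setIntegral_eq_zero_of_forall_eq_zero
    intro x hx
    apply hR
    have : R + 1 < x := hx
    rw [abs_of_pos (by linarith)]; linarith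
  have split : ∀ t, ∫ x in Iic t, m x = I - ∫ x in Ioi t, m x := by
    intro t
    have := integral_add_compl (s := Iic t) measurableSet_Iic hm
    rw [compl_Iic] at this; linarith
  have J : ∀ t, ∫ x in Iic t, m x = ∫ x in (-R-1)..t, m x := by
    intro t
    rw [← intervalIntegral.integral_Iic_sub_Iic hm.integrableOn hm.integrableOn, e1, sub_zero]
  have cont : Continuous fun t => ∫ x in Iic t, m x := by
    simp_rw [J]
    exact intervalIntegral.continuous_primitive (fun a b => hm.intervalIntegrable) _
  have hr : I / 2 ∈ uIcc (∫ x in Iic (-R-1), m x) (∫ x in Iic (R+1), m x) := by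
    rw [e1, split (R+1), e2, sub_zero, mem_uIcc]
    rcases le_total 0 I with h | h
    · left; constructor <;> linarith
    · right; constructor <;> linarith
  obtain ⟨t, -, ht⟩ := intermediate_value_uIcc (cont.continuousOn (s := uIcc (-R-1) (R+1))) hr
  refine ⟨t, ?_, ?_⟩
  · rw [Measure.restrict_congr_set Iio_ae_eq_Iic]; exact ht
  · have := split t
    simp only at ht
    linarith

lemma T_exists {C : ℝ} (hC : 0 ≤ C)
    (hS : SProp (volume : Measure E) (fun x y => ⟪x, y⟫) C)
    (φ : ℝ × E → ℝ) (hφ : Measurable φ)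
    (φ0 : ∀ x, 0 ≤ φ x) (M R : ℝ) (hR0 : 0 ≤ R) (hM : ∀ x, φ x ≤ M) (hR : ∀ x, R < ‖x‖ → φ x = 0) :
    ∃ z : ℝ × E, ∀ ψ : ℝ × E → ℝ≥0∞, Measurable ψ →
      (∀ x y : ℝ × E, ENNReal.ofReal (φ (z + x)) * ψ y ≤
        ENNReal.ofReal (rexp (-(x.1 * y.1 + ⟪x.2, y.2⟫)))) →
      (∫⁻ q, ENNReal.ofReal (φ q) ∂((volume : Measure ℝ).prod (volume : Measure E))) *
        ∫⁻ q, ψ q ∂((volume : Measure ℝ).prod (volume : Measure E)) ≤ ENNReal.ofReal (2 * π * C) := by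
  have hi : Integrable φ ((volume : Measure ℝ).prod (volume : Measure E)) := by
    simpa using bddsupp_integrable φ hφ φ0 M R hM hR (fun _ => (1:ℝ)) continuous_const
  set I := ∫ q, φ q ∂((volume : Measure ℝ).prod (volume : Measure E)) with hI
  have eI := ofReal_integral_eq_lintegral_ofReal hi (ae_of_all _ φ0)
  have I0 : 0 ≤ I := integral_nonneg φ0
  rcases I0.eq_or_lt with hz | Ipos
  · refine ⟨0, fun ψ _ _ => ?_⟩
    rw [← eI, ← hI, ← hz]; simp
  obtain ⟨t, ht1, ht2⟩ := median_exists (fun a => ∫ y, φ (a, y)) hi.integral_prod_left R hR0 (by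
    intro x hx
    have : ∀ y, φ (x, y) = 0 := fun y => hR _ (hx.trans_le (le_max_left _ _))
    simp [this])
  rw [← integral_prod _ hi, ← hI] at ht1 ht2
  have nuA : ∀ A : Set ℝ, (volume.restrict A).prod (volume : Measure E) =
        ((volume : Measure ℝ).prod volume).restrict (A ×ˢ univ) := by
    intro A
    rw [← Measure.prod_restrict, Measure.restrict_univ]
  have iA : ∀ (A : Set ℝ) {f : ℝ × E → ℝ},
      Integrable f ((volume : Measure ℝ).prod (volume : Measure E)) →
      Integrable f ((volume.restrict A).prod (volume : Measure E)) := by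
    intro A f hf
    rw [nuA]; exact hf.restrict
  have iA2 : ∀ (A : Set ℝ) {f : ℝ × E → E},
      Integrable f ((volume : Measure ℝ).prod (volume : Measure E)) →
      Integrable f ((volume.restrict A).prod (volume : Measure E)) := by
    intro A f hf
    rw [nuA]; exact hf.restrict
  have int1 : Integrable (fun q : ℝ × E => φ q * (q.1 - t)) ((volume : Measure ℝ).prod (volume : Measure E)) :=
    bddsupp_integrable φ hφ φ0 M R hM hR (fun q => q.1 - t) (by fun_prop)
  have int2 : Integrable (fun q : ℝ × E => φ q • q.2) ((volume : Measure ℝ).prod (volume : Measure E)) :=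
    bddsupp_integrable φ hφ φ0 M R hM hR (fun q => q.2) (by fun_prop)
  have int2w : ∀ w, Integrable (fun q : ℝ × E => φ q * ⟪q.2, w⟫) ((volume : Measure ℝ).prod (volume : Measure E)) :=
    fun w => bddsupp_integrable φ hφ φ0 M R hM hR (fun q => ⟪q.2, w⟫) (by fun_prop)
  have massP : ∫ q, φ q ∂((volume.restrict (Ioi t)).prod (volume : Measure E)) = I / 2 := by
    rw [integral_prod _ (iA _ hi)]; exact ht2
  have massM : ∫ q, φ q ∂((volume.restrict (Iio t)).prod (volume : Measure E)) = I / 2 := by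
    rw [integral_prod _ (iA _ hi)]; exact ht1
  set a := ∫ q, φ q * (q.1 - t) ∂((volume.restrict (Ioi t)).prod (volume : Measure E)) with ha
  set b := ∫ q, φ q * (q.1 - t) ∂((volume.restrict (Iio t)).prod (volume : Measure E)) with hb
  set c := ∫ q, φ q • q.2 ∂((volume.restrict (Ioi t)).prod (volume : Measure E)) with hc
  set d := ∫ q, φ q • q.2 ∂((volume.restrict (Iio t)).prod (volume : Measure E)) with hd
  have aeP : ∀ᵐ q ∂((volume.restrict (Ioi t)).prod (volume : Measure E)), t < q.1 :=
    Measure.quasiMeasurePreserving_fst.ae (ae_restrict_mem measurableSet_Ioi)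
  have aeM : ∀ᵐ q ∂((volume.restrict (Iio t)).prod (volume : Measure E)), q.1 < t :=
    Measure.quasiMeasurePreserving_fst.ae (ae_restrict_mem measurableSet_Iio)
  have apos : 0 < a := by
    have nn : 0 ≤ᵐ[(volume.restrict (Ioi t)).prod (volume : Measure E)] fun q => φ q * (q.1 - t) := by
      filter_upwards [aeP] with q hq
      exact mul_nonneg (φ0 q) (by linarith)
    refine lt_of_le_of_ne (integral_nonneg_of_ae nn) fun h0 => ?_
    have := (integral_eq_zero_iff_of_nonneg_ae nn (iA _ int1)).1 h0.symm
    have z : φ =ᵐ[(volume.restrict (Ioi t)).prod (volume : Measure E)] 0 := by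
      filter_upwards [this, aeP] with q h1 h2
      rcases mul_eq_zero.1 h1 with h | h
      · exact h
      · exact absurd h (by linarith)
    rw [integral_congr_ae z] at massP
    simp at massP; linarith
  have bneg : b ≤ 0 := by
    apply integral_nonpos_of_ae
    filter_upwards [aeM] with q hq
    exact mul_nonpos_of_nonneg_of_nonpos (φ0 q) (by linarith)
  have ab : a - b ≠ 0 := by linarith
  set v := (a - b)⁻¹ • (c - d) with hv
  set z := (I / 2)⁻¹ • (c - a • v) with hz
  have hcz : c = (I / 2) • z + a • v := by
    rw [hz, smul_inv_smul₀ (by linarith)]; abel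
  have hdz : d = (I / 2) • z + b • v := by
    have : (a - b) • v = c - d := by rw [hv, smul_inv_smul₀ ab]
    have h3 : d = c - (a - b) • v := by rw [this]; abel
    rw [h3, sub_smul, hcz]; abel
  have innerc : ∀ (A : Set ℝ) (w : E), ∫ q, φ q * ⟪q.2, w⟫ ∂((volume.restrict A).prod (volume : Measure E))
      = ⟪∫ q, φ q • q.2 ∂((volume.restrict A).prod (volume : Measure E)), w⟫ := by
    intro A w
    rw [real_inner_comm, ← integral_inner (iA2 A int2) w]
    congr 1; ext q
    rw [inner_smul_right, real_inner_comm]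
  refine ⟨(t, z), fun ψ hψ h => ?_⟩
  have hA1 : MeasurePreserving (fun s : ℝ => t + 1 * s) (volume.restrict (Ioi (0:ℝ))) (volume.restrict (Ioi t)) := by
    have := (measurePreserving_add_left (volume : Measure ℝ) t).restrict_preimage (s := Ioi t) measurableSet_Ioi
    simpa using this
  have hA2 : MeasurePreserving (fun s : ℝ => t + (-1) * s) (volume.restrict (Ioi (0:ℝ))) (volume.restrict (Iio t)) := by
    have := (Measure.measurePreserving_sub_left (volume : Measure ℝ) t).restrict_preimage (s := Iio t) measurableSet_Iio
    simpa [← sub_eq_add_neg] using this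
  have k1 := half_case hC hS φ ψ hφ hψ φ0 (Ioi t) t 1 (by norm_num) z v hA1 (iA _ hi) (iA _ int1)
    (fun w => iA _ (int2w w)) (by
      intro w
      rw [innerc, ← hc, massP, ← ha, hcz, inner_add_left, real_inner_smul_left z, real_inner_smul_left v]; ring) h
  have k2 := half_case hC hS φ ψ hφ hψ φ0 (Iio t) t (-1) (by norm_num) z v hA2 (iA _ hi) (iA _ int1)
    (fun w => iA _ (int2w w)) (by
      intro w
      rw [innerc, ← hd, massM, ← hb, hdz, inner_add_left, real_inner_smul_left z, real_inner_smul_left v]; ring) h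
  rw [← ofReal_integral_eq_lintegral_ofReal (iA _ hi) (ae_of_all _ φ0), massP] at k1
  rw [← ofReal_integral_eq_lintegral_ofReal (iA _ hi) (ae_of_all _ φ0), massM] at k2
  rw [← eI, ← lint_split ψ hψ v, ← hI]
  have : ENNReal.ofReal I = 2 * ENNReal.ofReal (I / 2) := by
    rw [← ENNReal.ofReal_ofNat, ← ENNReal.ofReal_mul (by norm_num)]; congr 1; ring
  rw [this, mul_assoc, mul_add]
  calc _ ≤ 2 * (ENNReal.ofReal (π / 2 * C) + ENNReal.ofReal (π / 2 * C)) := by gcongr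
    _ = _ := by
      rw [← ENNReal.ofReal_add (by positivity) (by positivity), ← ENNReal.ofReal_ofNat,
        ← ENNReal.ofReal_mul (by norm_num)]; congr 1; ring

lemma S_prod {C : ℝ} (hC : 0 ≤ C)
    (hS : SProp (volume : Measure E) (fun x y => ⟪x, y⟫) C) :
    SProp ((volume : Measure ℝ).prod (volume : Measure E))
      (fun x y => x.1 * y.1 + ⟪x.2, y.2⟫) (2 * π * C) := by
  intro f g hf hg f0 fi fm h
  set gk : ℕ → ℝ × E → ℝ≥0∞ := fun k => (closedBall 0 (k:ℝ)).indicator (fun y => min (g y) k) with hgk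
  have mgk : ∀ k, Measurable (gk k) := fun k =>
    (hg.min measurable_const).indicator measurableSet_closedBall
  have gkle : ∀ k y, gk k y ≤ g y := fun k y =>
    (indicator_le_self _ _ y).trans (min_le_left _ _)
  have gklek : ∀ k y, gk k y ≤ k := fun k y =>
    (indicator_le_self _ _ y).trans (min_le_right _ _)
  have gsup : ∫⁻ y, g y ∂((volume : Measure ℝ).prod (volume : Measure E)) =
      ⨆ k, ∫⁻ y, gk k y ∂((volume : Measure ℝ).prod (volume : Measure E)) := by
    rw [← lintegral_iSup mgk]
    · congr 1; ext y
      apply le_antisymm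
      · obtain ⟨k0, hk0⟩ := exists_nat_ge ‖y‖
        have e : ∀ k, k0 ≤ k → gk k y = min (g y) k := by
          intro k hk
          rw [hgk]
          simp only
          rw [indicator_of_mem]
          simp only [mem_closedBall, dist_zero_right]
          exact hk0.trans (by exact_mod_cast hk)
        by_cases hx : g y = ⊤
        · rw [hx]
          rw [← ENNReal.iSup_natCast]
          refine iSup_le fun k => ?_
          refine le_iSup_of_le (max k k0) ?_
          rw [e _ (le_max_right _ _), hx]
          simp
        · obtain ⟨k, hk⟩ := ENNReal.exists_nat_gt hx
          refine le_iSup_of_le (max k k0) ?_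
          rw [e _ (le_max_right _ _), min_eq_left]
          exact hk.le.trans (by exact_mod_cast le_max_left _ _)
      · exact iSup_le fun k => gkle k y
    · intro i j hij y
      have hij' : (i : ℝ) ≤ j := by exact_mod_cast hij
      refine (indicator_le_indicator_of_subset (closedBall_subset_closedBall hij') (fun _ => zero_le) y).trans ?_
      apply indicator_le_indicator
      gcongr
  rw [gsup, ENNReal.mul_iSup]
  refine iSup_le fun k => ?_
  have fin : ∀ y, gk k y ≠ ⊤ := fun y => ne_top_of_le_ne_top (ENNReal.natCast_ne_top k) (gklek k y)
  obtain ⟨z, hz⟩ := T_exists hC hS (fun y => (gk k y).toReal) (mgk k).ennreal_toReal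
    (fun _ => ENNReal.toReal_nonneg) k k (by positivity)
    (fun y => by
      have := ENNReal.toReal_mono (ENNReal.natCast_ne_top k) (gklek k y)
      simpa using this)
    (fun y hy => by
      have : gk k y = 0 := by
        rw [hgk]; simp only
        rw [indicator_of_notMem]
        simpa using hy
      simp [this])
  have := hz (fun x => ENNReal.ofReal (f x * rexp (z.1 * x.1 + ⟪z.2, x.2⟫)))
    (Measurable.ennreal_ofReal (by fun_prop)) (by
      intro y x
      rw [ENNReal.ofReal_toReal (fin _), ENNReal.ofReal_mul (f0 x)]
      calc gk k (z + y) * (ENNReal.ofReal (f x) * ENNReal.ofReal (rexp (z.1 * x.1 + ⟪z.2, x.2⟫)))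
          = ENNReal.ofReal (f x) * gk k (z + y) * ENNReal.ofReal (rexp (z.1 * x.1 + ⟪z.2, x.2⟫)) := by ring
        _ ≤ ENNReal.ofReal (rexp (-(x.1 * (z + y).1 + ⟪x.2, (z + y).2⟫))) * ENNReal.ofReal (rexp (z.1 * x.1 + ⟪z.2, x.2⟫)) := by
            gcongr
            exact (mul_le_mul_right (gkle _ _) _).trans (h x (z + y))
        _ = _ := by
            rw [← ENNReal.ofReal_mul (by positivity), ← Real.exp_add]
            congr 2
            simp only [Prod.fst_add, Prod.snd_add, inner_add_right, real_inner_comm x.2]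
            ring)
  simp only [ENNReal.ofReal_toReal (fin _)] at this
  rw [mul_comm]
  refine le_trans ?_ this
  refine mul_le_mul_right ?_ _
  obtain ⟨m1, m2⟩ := fm z
  have i3 : Integrable (fun x => f x + f x * (x.1 * z.1 + ⟪x.2, z.2⟫)) ((volume : Measure ℝ).prod (volume : Measure E)) := fi.add m1
  rw [← ofReal_integral_eq_lintegral_ofReal fi (ae_of_all _ f0)]
  have e : ∫ x, f x ∂((volume : Measure ℝ).prod (volume : Measure E)) =
      ∫ x, (f x + f x * (x.1 * z.1 + ⟪x.2, z.2⟫)) ∂((volume : Measure ℝ).prod (volume : Measure E)) := by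
    rw [integral_add fi m1, m2, add_zero]
  rw [e]
  calc _ ≤ ENNReal.ofReal (∫ x, max (f x + f x * (x.1 * z.1 + ⟪x.2, z.2⟫)) 0 ∂((volume : Measure ℝ).prod (volume : Measure E))) := by
        apply ENNReal.ofReal_le_ofReal
        exact integral_mono i3 i3.pos_part fun x => le_max_left _ _
    _ = ∫⁻ x, ENNReal.ofReal (max (f x + f x * (x.1 * z.1 + ⟪x.2, z.2⟫)) 0) ∂((volume : Measure ℝ).prod (volume : Measure E)) :=
        ofReal_integral_eq_lintegral_ofReal i3.pos_part (ae_of_all _ fun x => le_max_right _ _)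
    _ ≤ _ := by
        apply lintegral_mono
        intro x
        apply ENNReal.ofReal_le_ofReal
        apply max_le
        · have := Real.add_one_le_exp (z.1 * x.1 + ⟪z.2, x.2⟫)
          have h2 := mul_le_mul_of_nonneg_left this (f0 x)
          rw [real_inner_comm x.2 z.2] at h2 ⊢
          nlinarith
        · exact mul_nonneg (f0 x) (exp_pos _).le
end

lemma S_transfer {X Y : Type*} [MeasurableSpace X] [MeasurableSpace Y] (μ : Measure X) (ν : Measure Y)
    (e : X ≃ᵐ Y) (he : MeasurePreserving e μ ν) (p : X → X → ℝ) (q : Y → Y → ℝ)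
    (h : ∀ x y, q (e x) (e y) = p x y) (C : ℝ) (hS : SProp μ p C) : SProp ν q C := by
  intro f g hf hg f0 fi fm hfg
  have := hS (fun x => f (e x)) (fun x => g (e x)) (hf.comp e.measurable) (hg.comp e.measurable)
    (fun x => f0 _) (he.integrable_comp_of_integrable fi) (by
      intro w
      obtain ⟨h1, h2⟩ := fm (e w)
      simp only [← h]
      refine ⟨he.integrable_comp_of_integrable h1, ?_⟩
      rw [← h2]
      exact he.integral_comp e.measurableEmbedding (fun y => f y * q y (e w)))
    (by
      intro x y
      rw [← h]; exact hfg _ _)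
  rwa [he.lintegral_comp hf.ennreal_ofReal, he.lintegral_comp hg] at this

lemma S_euclid (n : ℕ) : SProp (volume : Measure (EuclideanSpace ℝ (Fin n))) (fun x y => ⟪x, y⟫)
    ((2 * π) ^ n) := by
  induction n with
  | zero =>
    intro f g hf hg f0 fi fm h
    have hv : (volume : Measure (EuclideanSpace ℝ (Fin 0))) = Measure.dirac 0 := by
      exact volume_euclideanSpace_eq_dirac _
    rw [hv, lintegral_dirac' _ hf.ennreal_ofReal, lintegral_dirac' _ hg]
    simpa using h 0 0
  | succ n ih =>
    have h := S_prod (by positivity) ih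
    rw [show (2 * π) ^ (n + 1) = 2 * π * (2 * π) ^ n by ring]
    set e : ℝ × EuclideanSpace ℝ (Fin n) ≃ᵐ EuclideanSpace ℝ (Fin (n+1)) :=
      ((MeasurableEquiv.prodCongr (MeasurableEquiv.refl ℝ) (MeasurableEquiv.toLp 2 (Fin n → ℝ)).symm).trans
        (MeasurableEquiv.piFinSuccAbove (fun _ => ℝ) 0).symm).trans (MeasurableEquiv.toLp 2 (Fin (n+1) → ℝ))
      with he
    refine S_transfer _ _ e ?_ _ _ ?_ _ h
    · have h1 : MeasurePreserving (Prod.map id (@WithLp.ofLp 2 (Fin n → ℝ)))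
        ((volume : Measure ℝ).prod (volume : Measure (EuclideanSpace ℝ (Fin n)))) (volume.prod volume) :=
        (MeasurePreserving.id _).prod (PiLp.volume_preserving_ofLp (Fin n))
      have h2 := (volume_preserving_piFinSuccAbove (fun _ : Fin (n + 1) => ℝ) 0).symm
      have h3 := (PiLp.volume_preserving_toLp (Fin (n+1)))
      exact h3.comp (h2.comp h1)
    · intro x y
      rw [PiLp.inner_apply, Fin.sum_univ_succ, PiLp.inner_apply]
      simp [he, MeasurableEquiv.prodCongr, mul_comm]

lemma scale_Ioi (c : ℝ) (hc : 0 < c) (G : ℝ → ℝ≥0∞) :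
    ∫⁻ r in Ioi (0:ℝ), G (c * r) = ENNReal.ofReal c⁻¹ * ∫⁻ r in Ioi (0:ℝ), G r := by
  have := lintegral_image_eq_lintegral_abs_deriv_mul (s := Ioi (0:ℝ)) (f := fun r => c * r) (f' := fun _ => c)
    measurableSet_Ioi (fun x _ => by simpa using ((hasDerivAt_id x).const_mul c).hasDerivWithinAt)
    (fun x _ y _ h => by simpa [hc.ne'] using h) G
  have im : (fun r => c * r) '' Ioi (0:ℝ) = Ioi 0 := by
    ext x; constructor
    · rintro ⟨y, hy, rfl⟩; exact mul_pos hc hy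
    · intro hx; exact ⟨c⁻¹ * x, mul_pos (inv_pos.2 hc) hx, by simp [hc.ne']⟩
  rw [im, lintegral_const_mul' _ _ (by simp), abs_of_pos hc] at this
  rw [this, ← mul_assoc, ← ENNReal.ofReal_mul (by positivity)]
  simp [hc.ne']

lemma polar_hom {E : Type*} [NormedAddCommGroup E] [InnerProductSpace ℝ E] [FiniteDimensional ℝ E]
    [MeasurableSpace E] [BorelSpace E] [Nontrivial E] {n : ℕ} (hn : 1 ≤ n) (hfr : Module.finrank ℝ E = n) (k : ℕ) (N : E → ℝ) (hN : Continuous N)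
    (hNh : ∀ r > 0, ∀ x, N (r • x) = r * N x) (hNp : ∀ x ≠ 0, 0 < N x)
    (l : E → ℝ≥0∞) (hl : Measurable l)
    (hlh : ∀ r > 0, ∀ x, l (r • x) = ENNReal.ofReal r ^ k * l x)
    (Φ : ℝ → ℝ≥0∞) (hΦ : Measurable Φ) :
    ∫⁻ x, Φ (N x) * l x = (∫⁻ u, l u * ENNReal.ofReal ((N u)⁻¹ ^ (n + k))
        ∂((volume : Measure (E)).toSphere)) *
      ∫⁻ r in Ioi (0:ℝ), Φ r * ENNReal.ofReal (r ^ (n - 1 + k)) := by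
  have mN := hN.measurable
  have h1 : ∫⁻ x, Φ (N x) * l x = ∫⁻ x : ({(0)}ᶜ : Set E), Φ (N x) * l x ∂((volume : Measure E).comap (↑)) := by
    rw [lintegral_subtype_comap (measurableSet_singleton _).compl (fun x => Φ (N x) * l x), restrict_compl_singleton]
  have mp := (volume : Measure E).measurePreserving_homeomorphUnitSphereProd
  have h2 : ∫⁻ x : ({(0)}ᶜ : Set E), Φ (N x) * l x ∂((volume : Measure E).comap (↑)) =
      ∫⁻ q : sphere (0:E) 1 × Ioi (0:ℝ), Φ (q.2 * N q.1) * (ENNReal.ofReal q.2 ^ k * l q.1)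
        ∂((volume : Measure E).toSphere.prod (.volumeIoiPow (Module.finrank ℝ E - 1))) := by
    rw [← mp.lintegral_comp_emb (Homeomorph.measurableEmbedding _)]
    congr 1; ext x
    have hx : 0 < ‖(x : E)‖ := norm_pos_iff.2 x.2
    have e : (x : E) = ‖(x:E)‖ • ((homeomorphUnitSphereProd E x).1 : E) := by
      simp [smul_smul, hx.ne']
    rw [homeomorphUnitSphereProd_apply_snd_coe, ← hlh _ hx, ← hNh _ hx, ← e]
  rw [h1, h2, lintegral_prod _ (by fun_prop), ← lintegral_mul_const _ (by fun_prop)]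
  congr 1; ext u
  have hu : 0 < N u := hNp _ (by
    intro h
    have := u.2
    rw [mem_sphere, h] at this
    simp at this)
  rw [Measure.volumeIoiPow, lintegral_withDensity_eq_lintegral_mul _ (by fun_prop) (by fun_prop)]
  have h3 := lintegral_subtype_comap (μ := volume) (measurableSet_Ioi (a := (0:ℝ))) (fun r => ENNReal.ofReal (r ^ (Module.finrank ℝ E - 1)) * (Φ (r * N u) * (ENNReal.ofReal r ^ k * l u)))
  refine h3.trans ?_
  rw [hfr]
  have h4 : ∫⁻ r in Ioi (0:ℝ), ENNReal.ofReal (r ^ (n - 1)) * (Φ (r * N u) * (ENNReal.ofReal r ^ k * l u)) =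
     ∫⁻ r in Ioi (0:ℝ), l u * ENNReal.ofReal ((N u)⁻¹ ^ (n - 1 + k)) * (Φ (N u * r) * ENNReal.ofReal ((N u * r) ^ (n - 1 + k))) := by
    apply setLIntegral_congr_fun measurableSet_Ioi
    intro r hr
    have hr : 0 < r := hr
    simp only
    rw [mul_comm r (N u), mul_pow, inv_pow, ENNReal.ofReal_mul (by positivity), pow_add r, ENNReal.ofReal_mul (by positivity),
      ENNReal.ofReal_pow hr.le k]
    have : ENNReal.ofReal ((N u ^ (n - 1 + k))⁻¹) * ENNReal.ofReal (N u ^ (n - 1 + k)) = 1 := by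
      rw [← ENNReal.ofReal_mul (by positivity), inv_mul_cancel₀ (by positivity)]; simp
    calc _ = 1 * (ENNReal.ofReal (r ^ (n - 1)) * (Φ (N u * r) * (ENNReal.ofReal r ^ k * l u))) := by rw [one_mul]
      _ = _ := by rw [← this]; ring
  rw [h4, lintegral_const_mul _ (by fun_prop), scale_Ioi _ hu (fun r => Φ r * ENNReal.ofReal (r ^ (n - 1 + k))),
    ← mul_assoc, mul_assoc (l u), ← ENNReal.ofReal_mul (by positivity), ← pow_succ,
    show n - 1 + k + 1 = n + k by omega]

lemma radial_i (m : ℕ) : (∫⁻ r in Ioi (0:ℝ), (Iic (1:ℝ)).indicator 1 r * ENNReal.ofReal (r ^ m)) ≠ 0 ∧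
    (∫⁻ r in Ioi (0:ℝ), (Iic (1:ℝ)).indicator 1 r * ENNReal.ofReal (r ^ m)) ≠ ∞ := by
  have e : (∫⁻ r in Ioi (0:ℝ), (Iic (1:ℝ)).indicator 1 r * ENNReal.ofReal (r ^ m)) =
      ∫⁻ r in Ioc (0:ℝ) 1, ENNReal.ofReal (r ^ m) := by
    have : ∀ r : ℝ, (Iic (1:ℝ)).indicator 1 r * ENNReal.ofReal (r ^ m) =
        (Iic (1:ℝ)).indicator (fun r => ENNReal.ofReal (r ^ m)) r := by
      intro r
      by_cases h : r ∈ Iic (1:ℝ) <;> simp [indicator, h]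
    simp_rw [this]
    rw [lintegral_indicator measurableSet_Iic, Measure.restrict_restrict measurableSet_Iic]
    congr 2
    ext x; simp [and_comm]
  rw [e]
  constructor
  · have h1 : ∫⁻ r in Ioc (2⁻¹:ℝ) 1, ENNReal.ofReal (2⁻¹ ^ m) ≤ ∫⁻ r in Ioc (0:ℝ) 1, ENNReal.ofReal (r ^ m) := by
      refine (setLIntegral_mono' measurableSet_Ioc ?_).trans (lintegral_mono_set (Ioc_subset_Ioc_left (by norm_num)))
      intro r hr
      exact ENNReal.ofReal_le_ofReal (pow_le_pow_left₀ (by norm_num) hr.1.le _)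
    have h2 : 0 < ∫⁻ r in Ioc (2⁻¹:ℝ) 1, ENNReal.ofReal (2⁻¹ ^ m) := by
      rw [setLIntegral_const, Real.volume_Ioc, ← ENNReal.ofReal_mul (by positivity)]
      simp only [ENNReal.ofReal_pos]
      norm_num
    exact (h2.trans_le h1).ne'
  · have h1 : ∫⁻ r in Ioc (0:ℝ) 1, ENNReal.ofReal (r ^ m) ≤ ∫⁻ r in Ioc (0:ℝ) 1, 1 := by
      refine setLIntegral_mono' measurableSet_Ioc ?_
      intro r hr
      rw [← ENNReal.ofReal_one]
      exact ENNReal.ofReal_le_ofReal (pow_le_one₀ hr.1.le hr.2)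
    refine (h1.trans_lt ?_).ne
    simp

lemma radial_d (m : ℕ) : (∫⁻ r in Ioi (0:ℝ), ENNReal.ofReal (rexp (-r^2/2)) * ENNReal.ofReal (r ^ m)) ≠ 0 ∧
    (∫⁻ r in Ioi (0:ℝ), ENNReal.ofReal (rexp (-r^2/2)) * ENNReal.ofReal (r ^ m)) ≠ ∞ := by
  constructor
  · have h : ENNReal.ofReal (rexp (-1/2)) * (∫⁻ r in Ioi (0:ℝ), (Iic (1:ℝ)).indicator 1 r * ENNReal.ofReal (r ^ m)) ≤
      (∫⁻ r in Ioi (0:ℝ), ENNReal.ofReal (rexp (-r^2/2)) * ENNReal.ofReal (r ^ m)) := by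
      rw [← lintegral_const_mul' _ _ (by simp)]
      refine setLIntegral_mono' measurableSet_Ioi ?_
      intro r hr
      have hr : 0 < r := hr
      by_cases h : r ∈ Iic (1:ℝ)
      · simp only [indicator, h, if_true, Pi.one_apply, one_mul]
        gcongr
        have : r ≤ 1 := h
        nlinarith
      · simp [indicator, h]
    have h0 := (radial_i m).1
    intro h1
    rw [h1] at h
    simp only [nonpos_iff_eq_zero, mul_eq_zero] at h
    rcases h with h | h
    · simp only [ENNReal.ofReal_eq_zero] at h
      exact absurd h (not_le.2 (exp_pos _))
    · exact h0 h
  · have h := integrable_rpow_mul_exp_neg_mul_sq (b := 1/2) (by norm_num) (s := m) (by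
      have : (0:ℝ) ≤ m := by positivity
      linarith)
    have h2 := h.lintegral_lt_top
    refine (lt_of_le_of_lt ?_ h2).ne
    refine (setLIntegral_mono' measurableSet_Ioi ?_).trans (setLIntegral_le_lintegral (Ioi 0) _)
    intro r hr
    rw [← ENNReal.ofReal_mul (by positivity), Real.rpow_natCast, mul_comm]
    apply le_of_eq
    congr 3
    ring

set_option linter.unusedSectionVars false
section
variable {E : Type*} [NormedAddCommGroup E] [InnerProductSpace ℝ E] [FiniteDimensional ℝ E]
    [MeasurableSpace E] [BorelSpace E] [Nontrivial E]

lemma A_fin (N : E → ℝ) (hN : Continuous N) (hNp : ∀ x ≠ 0, 0 < N x) (l : E → ℝ) (hl : Continuous l) (m : ℕ) :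
    ∫⁻ u, ENNReal.ofReal (l u) * ENNReal.ofReal ((N u)⁻¹ ^ m) ∂((volume : Measure E).toSphere) ≠ ∞ := by
  have hp : ∀ u : sphere (0:E) 1, 0 < N u := fun u => hNp _ (by
    intro h
    have := u.2
    rw [mem_sphere, h] at this
    simp at this)
  have hc : Continuous (fun u : sphere (0:E) 1 => l u * (N u)⁻¹ ^ m) := by
    refine (hl.comp continuous_subtype_val).mul (Continuous.pow (Continuous.inv₀ (hN.comp continuous_subtype_val) ?_) m)
    exact fun u => (hp u).ne'
  have hi : Integrable (fun u : sphere (0:E) 1 => l u * (N u)⁻¹ ^ m) ((volume : Measure E).toSphere) :=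
    hc.integrable_of_hasCompactSupport (HasCompactSupport.of_compactSpace _)
  refine (lt_of_le_of_lt ?_ hi.lintegral_lt_top).ne
  refine lintegral_mono fun u => ?_
  simp only
  rw [ENNReal.ofReal_mul' (by have := hp u; positivity)]

lemma bs_hom {n : ℕ} (hn : 1 ≤ n) (hfr : Module.finrank ℝ E = n)
    (hS : SProp (volume : Measure E) (fun x y => ⟪x, y⟫) ((2 * π) ^ n))
    (N S : E → ℝ) (hN : Continuous N)
    (hNh : ∀ r > 0, ∀ x, N (r • x) = r * N x) (hNp : ∀ x ≠ 0, 0 < N x)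
    (hSc : Continuous S)
    (hSh : ∀ r > 0, ∀ x, S (r • x) = r * S x) (hSp : ∀ x ≠ 0, 0 < S x)
    (hNS : ∀ x y, ⟪x, y⟫ ≤ N x * S y)
    (hv : volume {x | N x ≤ 1} = volume (closedBall (0:E) 1))
    (hmi : ∀ w, IntegrableOn (fun x => ⟪x, w⟫) {x | N x ≤ 1})
    (hm : ∀ w, ∫ x in {x | N x ≤ 1}, ⟪x, w⟫ = 0) :
    ∫⁻ u, ENNReal.ofReal ((S u)⁻¹ ^ n) ∂((volume : Measure E).toSphere) ≤ (volume : Measure E).toSphere univ := by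
  have mN := hN.measurable
  have mS := hSc.measurable
  set ω := (volume : Measure E).toSphere univ with hω
  set A := fun N : E → ℝ => ∫⁻ u, ENNReal.ofReal ((N u)⁻¹ ^ n) ∂((volume : Measure E).toSphere) with hA
  set i0 := ∫⁻ r in Ioi (0:ℝ), (Iic (1:ℝ)).indicator 1 r * ENNReal.ofReal (r ^ (n - 1)) with hi0
  set d0 := ∫⁻ r in Ioi (0:ℝ), ENNReal.ofReal (rexp (-r^2/2)) * ENNReal.ofReal (r ^ (n - 1)) with hd0
  have mI : Measurable ((Iic (1:ℝ)).indicator (1 : ℝ → ℝ≥0∞)) := measurable_one.indicator measurableSet_Iic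
  have mG : Measurable (fun r : ℝ => ENNReal.ofReal (rexp (-r^2/2))) := by fun_prop
  have A1 : A (fun x => ‖x‖) = ω := by
    simp [hA, hω]
  have VI : ∀ N : E → ℝ, Continuous N → (∀ r > 0, ∀ x, N (r • x) = r * N x) → (∀ x ≠ 0, 0 < N x) →
      volume {x | N x ≤ 1} = A N * i0 := by
    intro N hN h1 h2
    have := polar_hom hn hfr 0 N hN h1 h2 1 measurable_one (by simp) _ mI
    simp only [Pi.one_apply, mul_one, one_mul, add_zero] at this
    rw [← this, ← lintegral_indicator_one (measurableSet_le hN.measurable measurable_const)]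
    rfl
  have VD : ∀ N : E → ℝ, Continuous N → (∀ r > 0, ∀ x, N (r • x) = r * N x) → (∀ x ≠ 0, 0 < N x) →
      ∫⁻ x, ENNReal.ofReal (rexp (-(N x)^2/2)) = A N * d0 := by
    intro N hN h1 h2
    have := polar_hom hn hfr 0 N hN h1 h2 1 measurable_one (by simp) _ mG
    simpa only [Pi.one_apply, mul_one, one_mul, add_zero] using this
  have nh : ∀ r > (0:ℝ), ∀ x : E, ‖r • x‖ = r * ‖x‖ := by
    intro r hr x; rw [norm_smul, Real.norm_of_nonneg hr.le]
  have np : ∀ x : E, x ≠ 0 → 0 < ‖x‖ := fun x hx => norm_pos_iff.2 hx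
  have ANe : A N = ω := by
    have e1 := VI N hN hNh hNp
    have e2 := VI (fun x => ‖x‖) continuous_norm nh np
    have e3 : {x : E | ‖x‖ ≤ 1} = closedBall 0 1 := by ext x; simp
    rw [e3, A1] at e2
    rw [hv, e2] at e1
    exact ((ENNReal.mul_left_inj (radial_i _).1 (radial_i _).2).1 e1).symm
  have gs : ENNReal.ofReal ((2 * π) ^ n) = (ω * d0) * (ω * d0) := by
    rw [← A1, ← VD (fun x => ‖x‖) continuous_norm nh np]
    have := GaussianFourier.integral_rexp_neg_mul_sq_norm (V := E) (b := 1/2) (by norm_num)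
    have gi : Integrable (fun v : E => rexp (-(1/2) * ‖v‖^2)) := by
      have := GaussianFourier.integrable_cexp_neg_mul_sq_norm_add (V := E) (b := 1/2) (by norm_num) 0 0
      have := this.re
      refine this.congr (ae_of_all _ fun v => ?_)
      simp [← Complex.ofReal_pow, Complex.exp_re]
    have e : ∫⁻ x : E, ENNReal.ofReal (rexp (-‖x‖^2/2)) = ENNReal.ofReal ((2 * π) ^ (n / 2 : ℝ)) := by
      rw [hfr] at this
      rw [show 2 * π = π / (1/2) by ring, ← this, ofReal_integral_eq_lintegral_ofReal gi (ae_of_all _ fun x => by positivity)]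
      congr 1; ext x; congr 2; ring
    rw [e, ← ENNReal.ofReal_mul (by positivity), ← Real.rpow_add (by positivity)]
    simp
  have hn0 : N 0 = 0 := by have := hNh 2 (by norm_num) 0; simp at this; linarith
  have hs0 : S 0 = 0 := by have := hSh 2 (by norm_num) 0; simp at this; linarith
  have key := hS (fun x => rexp (-(N x)^2/2)) (fun y => ENNReal.ofReal (rexp (-(S y)^2/2)))
    (by fun_prop) (by fun_prop) (fun x => by positivity) ?_ ?_ ?_
  · rw [VD N hN hNh hNp, VD S hSc hSh hSp, gs, ANe] at key
    have dp := radial_d (n-1)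
    have w0 : ω ≠ 0 := by
      intro h
      rw [h, zero_mul, zero_mul] at gs
      have : 0 < (2 * π) ^ n := by positivity
      simp only [ENNReal.ofReal_eq_zero] at gs
      linarith
    have w1 : ω ≠ ∞ := by rw [hω]; exact measure_ne_top _ _
    have k1 := (ENNReal.mul_le_mul_iff_right (mul_ne_zero w0 dp.1) (ENNReal.mul_ne_top w1 dp.2)).1 key
    exact (ENNReal.mul_le_mul_iff_left dp.1 dp.2).1 k1
  · refine ⟨by fun_prop, ?_⟩
    rw [hasFiniteIntegral_iff_ofReal (ae_of_all _ fun x => by positivity), VD N hN hNh hNp, ANe]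
    exact ENNReal.mul_lt_top (measure_lt_top _ _) (radial_d _).2.lt_top
  · intro w
    have mom : ∀ w : E, ∀ Φ : ℝ → ℝ≥0∞, Measurable Φ → 
        ∫⁻ x, Φ (N x) * ENNReal.ofReal ⟪x, w⟫ = (∫⁻ u, ENNReal.ofReal ⟪(u:E), w⟫ * ENNReal.ofReal ((N u)⁻¹ ^ (n + 1))
          ∂((volume : Measure E).toSphere)) * ∫⁻ r in Ioi (0:ℝ), Φ r * ENNReal.ofReal (r ^ (n - 1 + 1)) := by
      intro w Φ hΦ
      refine polar_hom hn hfr 1 N hN hNh hNp (fun x => ENNReal.ofReal ⟪x, w⟫) (by fun_prop) ?_ Φ hΦ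
      intro r hr x
      rw [real_inner_smul_left, ENNReal.ofReal_mul hr.le, pow_one]
    have afin : ∀ w : E, (∫⁻ u, ENNReal.ofReal ⟪(u:E), w⟫ * ENNReal.ofReal ((N u)⁻¹ ^ (n + 1))
          ∂((volume : Measure E).toSphere)) ≠ ∞ := fun w => A_fin N hN hNp (fun x => ⟪x, w⟫) (by fun_prop) _
    set a := fun w : E => (∫⁻ u, ENNReal.ofReal ⟪(u:E), w⟫ * ENNReal.ofReal ((N u)⁻¹ ^ (n + 1))
          ∂((volume : Measure E).toSphere)) with ha
    have ri := radial_i (n - 1 + 1)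
    have rd := radial_d (n - 1 + 1)
    have lset : ∀ w : E, ∫⁻ x in {x | N x ≤ 1}, ENNReal.ofReal ⟪x, w⟫ = a w *
        ∫⁻ r in Ioi (0:ℝ), (Iic (1:ℝ)).indicator 1 r * ENNReal.ofReal (r ^ (n - 1 + 1)) := by
      intro w
      rw [← mom w _ mI, ← lintegral_indicator (measurableSet_le hN.measurable measurable_const)]
      congr 1; ext x
      by_cases h : N x ≤ 1 <;> simp [indicator, h]
    have aeq : a w = a (-w) := by
      have h1 := integral_eq_lintegral_pos_part_sub_lintegral_neg_part (hmi w)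
      rw [hm w] at h1
      have e2 : ∀ x, - ⟪x, w⟫ = ⟪x, -w⟫ := fun x => (inner_neg_right _ _).symm
      simp only [e2] at h1
      rw [lset, lset] at h1
      have h3 := (ENNReal.toReal_eq_toReal_iff' (ENNReal.mul_ne_top (afin w) ri.2) (ENNReal.mul_ne_top (afin (-w)) ri.2)).1 (sub_eq_zero.1 h1.symm)
      exact (ENNReal.mul_left_inj ri.1 ri.2).1 h3
    have P : ∀ w, ∫⁻ x, ENNReal.ofReal (rexp (-(N x)^2/2) * ⟪x, w⟫) = a w *
        ∫⁻ r in Ioi (0:ℝ), ENNReal.ofReal (rexp (-r^2/2)) * ENNReal.ofReal (r ^ (n - 1 + 1)) := by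
      intro w
      rw [← mom w _ mG]
      congr 1; ext x
      rw [ENNReal.ofReal_mul (by positivity)]
    have Q : ∀ x, - (rexp (-(N x)^2/2) * ⟪x, w⟫) = rexp (-(N x)^2/2) * ⟪x, -w⟫ := by
      intro x; rw [inner_neg_right]; ring
    have int : Integrable (fun x => rexp (-(N x)^2/2) * ⟪x, w⟫) := by
      refine ⟨by fun_prop, ?_⟩
      have e : ∀ x, ‖rexp (-(N x)^2/2) * ⟪x, w⟫‖ₑ = ENNReal.ofReal (rexp (-(N x)^2/2) * ⟪x, w⟫) + 
          ENNReal.ofReal (rexp (-(N x)^2/2) * ⟪x, -w⟫) := by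
        intro x
        rw [← Q]
        generalize rexp (-(N x)^2/2) * ⟪x, w⟫ = t
        rw [Real.enorm_eq_ofReal_abs]
        rcases le_total 0 t with h | h
        · rw [abs_of_nonneg h, ENNReal.ofReal_of_nonpos (p := -t) (by linarith), add_zero]
        · rw [abs_of_nonpos h, ENNReal.ofReal_of_nonpos (p := t) (by linarith), zero_add]
      rw [HasFiniteIntegral]
      simp_rw [e]
      rw [lintegral_add_left (by fun_prop), P, P]
      exact ENNReal.add_lt_top.2 ⟨ENNReal.mul_lt_top (afin _).lt_top rd.2.lt_top, ENNReal.mul_lt_top (afin _).lt_top rd.2.lt_top⟩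
    refine ⟨int, ?_⟩
    rw [integral_eq_lintegral_pos_part_sub_lintegral_neg_part int]
    simp_rw [Q]
    rw [P, P, aeq, sub_self]
  · intro x y
    rw [← ENNReal.ofReal_mul (by positivity), ← Real.exp_add]
    apply ENNReal.ofReal_le_ofReal
    apply Real.exp_le_exp.2
    have := hNS x y
    nlinarith [sq_nonneg (N x - S y)]
end

section
variable {n : ℕ} {K : Set (EuclideanSpace ℝ (Fin n))}

lemma supp_ge (hK : IsCompact K) (u x : EuclideanSpace ℝ (Fin n)) (hx : x ∈ K) : ⟪x, u⟫ ≤ supp K u := by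
  apply le_csSup
  · exact (hK.image (by fun_prop)).bddAbove
  · exact ⟨x, hx, rfl⟩

lemma supp_att (hK : IsCompact K) (hne : K.Nonempty) (u : EuclideanSpace ℝ (Fin n)) :
    ∃ x ∈ K, ⟪x, u⟫ = supp K u := by
  have := (hK.image (f := fun x => ⟪x, u⟫) (by fun_prop)).sSup_mem (hne.image _)
  exact this

lemma supp_cont (hK : IsCompact K) : Continuous (supp K) := by
  refine hK.continuous_sSup (f := fun u x => ⟪x, u⟫) ?_
  change Continuous fun p : EuclideanSpace ℝ (Fin n) × EuclideanSpace ℝ (Fin n) => ⟪p.2, p.1⟫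
  fun_prop

lemma supp_smul (hK : IsCompact K) (hne : K.Nonempty) (r : ℝ) (hr : 0 < r) (u : EuclideanSpace ℝ (Fin n)) :
    supp K (r • u) = r * supp K u := by
  apply le_antisymm
  · obtain ⟨x, hx, h⟩ := supp_att hK hne (r • u)
    rw [← h, real_inner_smul_right]
    exact mul_le_mul_of_nonneg_left (supp_ge hK u x hx) hr.le
  · obtain ⟨x, hx, h⟩ := supp_att hK hne u
    rw [← h, ← real_inner_smul_right]
    exact supp_ge hK _ x hx

lemma supp_pos (hK : IsCompact K) (x : EuclideanSpace ℝ (Fin n)) (hx : x ∈ interior K)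
    (u : EuclideanSpace ℝ (Fin n)) (hu : u ≠ 0) : 0 < supp K u - ⟪x, u⟫ := by
  obtain ⟨δ, hδ, hb⟩ := Metric.isOpen_iff.1 isOpen_interior x hx
  have hun : 0 < ‖u‖ := norm_pos_iff.2 hu
  have hy : x + (δ / 2 / ‖u‖) • u ∈ K := by
    apply interior_subset
    apply hb
    rw [mem_ball, dist_eq_norm, add_sub_cancel_left, norm_smul, Real.norm_of_nonneg (by positivity)]
    rw [div_mul_cancel₀ _ hun.ne']
    linarith
  have := supp_ge hK u _ hy
  rw [inner_add_left, real_inner_smul_left, real_inner_self_eq_norm_sq] at this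
  have : 0 < δ / 2 / ‖u‖ * ‖u‖ ^ 2 := by positivity
  linarith

lemma centroid_exists (hK : IsConvexBody K) : ∃ c ∈ interior K, 
    IntegrableOn (fun x => x - c) K ∧ ∫ x in K, (x - c) = 0 := by
  obtain ⟨hc, hconv, z, hz⟩ := hK
  have hfin : volume K ≠ ∞ := hc.measure_lt_top.ne
  have h0 : volume K ≠ 0 := by
    have h1 : 0 < volume (interior K) := isOpen_interior.measure_pos _ ⟨z, hz⟩
    exact (h1.trans_le (measure_mono interior_subset)).ne'
  have : IsFiniteMeasure (volume.restrict K) := ⟨by simpa using hc.measure_lt_top⟩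
  have hInt : IntegrableOn (fun x : EuclideanSpace ℝ (Fin n) => x) K :=
    continuous_id.continuousOn.integrableOn_compact hc
  refine ⟨⨍ x in K, x, ?_, ?_, ?_⟩
  · obtain ⟨δ, hδ, hb⟩ := Metric.isOpen_iff.1 isOpen_interior z hz
    have hsub : closedBall z (δ/2) ⊆ interior K := (closedBall_subset_ball (by linarith)).trans hb
    have hsK := hsub.trans interior_subset
    refine hconv.average_mem_interior_of_set (t := closedBall z (δ/2)) ?_ (ae_restrict_mem hc.measurableSet) hInt ?_
    · rw [Measure.restrict_apply measurableSet_closedBall, inter_eq_left.2 hsK]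
      exact (measure_closedBall_pos _ _ (by linarith)).ne'
    · apply hsub
      refine (convex_closedBall z (δ/2)).set_average_mem isClosed_closedBall ?_ (measure_ne_top _ _) 
        (ae_restrict_mem measurableSet_closedBall) hInt.integrableOn
      rw [Measure.restrict_apply measurableSet_closedBall, inter_eq_left.2 hsK]
      exact (measure_closedBall_pos _ _ (by linarith)).ne'
  · exact Integrable.sub hInt (integrable_const _)
  · exact integral_sub_average _ _

lemma bs_body (hn : 1 ≤ n) (hK : IsConvexBody K) (hv : volume K = volume (closedBall (0 : EuclideanSpace ℝ (Fin n)) 1)) :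
    ∃ c ∈ interior K, ∫⁻ u, ENNReal.ofReal ((supp K u - ⟪c, (u : EuclideanSpace ℝ (Fin n))⟫)⁻¹ ^ n) ∂(sphMeasure n) ≤
      sphMeasure n univ := by
  obtain ⟨c, hc, hi, h0⟩ := centroid_exists hK
  obtain ⟨hcomp, hconv, hne⟩ := hK
  have hneK := hne.mono interior_subset
  refine ⟨c, hc, ?_⟩
  have : Nontrivial (EuclideanSpace ℝ (Fin n)) := by
    have : Nonempty (Fin n) := ⟨⟨0, hn⟩⟩
    infer_instance
  set L : Set (EuclideanSpace ℝ (Fin n)) := (fun x => x + c) ⁻¹' K with hL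
  have mp : MeasurePreserving (fun x : EuclideanSpace ℝ (Fin n) => x + c) volume volume :=
    measurePreserving_add_right volume c
  have me : MeasurableEmbedding (fun x : EuclideanSpace ℝ (Fin n) => x + c) := 
    (MeasurableEquiv.addRight c).measurableEmbedding
  have Lconv : Convex ℝ L := hconv.translate_preimage_left c
  have Lclosed : IsClosed L := hcomp.isClosed.preimage (by fun_prop)
  have Lcomp : IsCompact L := by
    have := (Homeomorph.addRight c).isCompact_preimage.2 hcomp
    exact this
  have L0 : L ∈ nhds (0 : EuclideanSpace ℝ (Fin n)) := by
    have h1 : K ∈ nhds ((0 : EuclideanSpace ℝ (Fin n)) + c) := by rw [zero_add]; exact mem_interior_iff_mem_nhds.1 hc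
    exact (show Continuous (fun x : EuclideanSpace ℝ (Fin n) => x + c) by fun_prop).continuousAt h1
  have Labs : Absorbent ℝ L := absorbent_nhds_zero L0
  have LN : {x | gauge L x ≤ 1} = L := by
    ext x
    rw [mem_ofPred_eq, gauge_le_one_iff_mem_closure Lconv L0, Lclosed.closure_eq]
  have gp : ∀ x ≠ 0, 0 < gauge L x := fun x hx => 
    (gauge_pos Labs (NormedSpace.isVonNBounded_of_isBounded ℝ Lcomp.isBounded)).2 hx
  have gh : ∀ r > (0:ℝ), ∀ x, gauge L (r • x) = r * gauge L x := fun r hr x => by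
    rw [gauge_smul_of_nonneg hr.le, smul_eq_mul]
  refine bs_hom hn (by simp) (S_euclid n) (gauge L) (fun y => supp K y - ⟪c, y⟫) (continuous_gauge Lconv L0) 
    gh gp ((supp_cont hcomp).sub (by fun_prop)) ?_ (fun x hx => supp_pos hcomp c hc x hx) ?_ ?_ ?_ ?_
  · intro r hr x
    rw [supp_smul hcomp hneK r hr, real_inner_smul_right]; ring
  · intro x y
    by_cases hx : x = 0
    · subst hx
      simp
    have g0 := gp x hx
    have : (gauge L x)⁻¹ • x ∈ L := by
      have h1 : (gauge L x)⁻¹ • x ∈ {x | gauge L x ≤ 1} := by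
        rw [mem_ofPred_eq, gh _ (by positivity), inv_mul_cancel₀ g0.ne']
      rwa [LN] at h1
    have := supp_ge hcomp y _ this
    rw [inner_add_left, real_inner_smul_left] at this
    have h2 : (gauge L x)⁻¹ * ⟪x, y⟫ ≤ supp K y - ⟪c, y⟫ := by linarith
    rw [inv_mul_le_iff₀ g0] at h2
    exact h2
  · rw [LN, mp.measure_preimage_emb me, hv]
  · intro w
    rw [LN]
    exact (show Continuous fun x : EuclideanSpace ℝ (Fin n) => ⟪x, w⟫ by fun_prop).continuousOn.integrableOn_compact Lcomp
  · intro w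
    rw [LN]
    have h1 := mp.setIntegral_preimage_emb me (fun y => ⟪y - c, w⟫) K
    simp only [add_sub_cancel_right] at h1
    rw [h1]
    have h2 := integral_inner (𝕜 := ℝ) hi w
    rw [h0, inner_zero_right] at h2
    simp_rw [real_inner_comm w]
    simpa [real_inner_comm] using h2
end

section
variable {n : ℕ} {K : Set (EuclideanSpace ℝ (Fin n))}

lemma sphere_ne (u : sphere (0 : EuclideanSpace ℝ (Fin n)) 1) : (u : EuclideanSpace ℝ (Fin n)) ≠ 0 := by
  intro h
  have := u.2
  rw [mem_sphere, h] at this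
  simp at this

instance sph_fin : IsFiniteMeasure (sphMeasure n) := by
  unfold sphMeasure; infer_instance

lemma cont_int (f : sphere (0 : EuclideanSpace ℝ (Fin n)) 1 → ℝ) (hf : Continuous f) : Integrable f (sphMeasure n) :=
  hf.integrable_of_hasCompactSupport (HasCompactSupport.of_compactSpace _)

lemma s_cont (hK : IsCompact K) (x : EuclideanSpace ℝ (Fin n)) :
    Continuous (fun u : sphere (0 : EuclideanSpace ℝ (Fin n)) 1 => supp K u - ⟪x, (u : EuclideanSpace ℝ (Fin n))⟫) := by
  refine ((supp_cont hK).comp continuous_subtype_val).sub (by fun_prop)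

lemma rpow_int (hK : IsCompact K) (x : EuclideanSpace ℝ (Fin n)) (hx : x ∈ interior K) (p : ℝ) :
    Integrable (fun u : sphere (0 : EuclideanSpace ℝ (Fin n)) 1 =>
      (supp K u - ⟪x, (u : EuclideanSpace ℝ (Fin n))⟫) ^ p) (sphMeasure n) := by
  apply cont_int
  refine (s_cont hK x).rpow_const fun u => Or.inl ?_
  exact (supp_pos hK x hx u (sphere_ne u)).ne'

lemma sph_mass : (sphMeasure n univ).toReal = n * vol (unitBall n) := by
  unfold sphMeasure vol unitBall
  rw [Measure.toSphere_apply_univ, Measure.addHaar_closedBall _ _ (by norm_num)]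
  simp

lemma good_one (K : Set (EuclideanSpace ℝ (Fin 1))) (hK : IsConvexBody K)
    (hv : volume K = volume (closedBall (0 : EuclideanSpace ℝ (Fin 1)) 1)) :
    ∃ x ∈ interior K, ∀ u : EuclideanSpace ℝ (Fin 1), ‖u‖ = 1 → 1 ≤ supp K u - ⟪x, u⟫ := by
  obtain ⟨hcomp, hconv, hne⟩ := hK
  have hneK := hne.mono interior_subset
  set u0 : EuclideanSpace ℝ (Fin 1) := EuclideanSpace.single 0 1 with hu0
  have u0n : ‖u0‖ = 1 := by simp [hu0]
  have rep : ∀ v : EuclideanSpace ℝ (Fin 1), v = ⟪v, u0⟫ • u0 := by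
    intro v
    ext i
    fin_cases i
    simp [hu0, PiLp.inner_apply]
  have nrm : ∀ v : EuclideanSpace ℝ (Fin 1), ‖v‖ = |⟪v, u0⟫| := by
    intro v
    conv_lhs => rw [rep v]
    rw [norm_smul, u0n, mul_one, Real.norm_eq_abs]
  obtain ⟨p, hp, hpa⟩ := supp_att hcomp hneK u0
  obtain ⟨q, hq, hqb⟩ := supp_att hcomp hneK (-u0)
  set a := supp K u0 with ha
  set b := supp K (-u0) with hb
  have ub : ∀ y ∈ K, ⟪y, u0⟫ ≤ a := fun y hy => supp_ge hcomp u0 y hy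
  have lb : ∀ y ∈ K, -⟪y, u0⟫ ≤ b := fun y hy => by
    rw [← inner_neg_right]; exact supp_ge hcomp (-u0) y hy
  rw [inner_neg_right] at hqb
  have hab : 0 < a + b := by
    obtain ⟨z, hz⟩ := hne
    have h1 := supp_pos hcomp z hz u0 (by intro h; rw [h] at u0n; simp at u0n)
    have h2 := lb z (interior_subset hz)
    linarith
  set x := ((a - b) / 2) • u0 with hx
  have xi : ⟪x, u0⟫ = (a - b) / 2 := by
    rw [hx, real_inner_smul_left, real_inner_self_eq_norm_sq, u0n]; ring
  have big : 1 ≤ (a + b) / 2 := by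
    have hsub : K ⊆ closedBall x ((a + b) / 2) := by
      intro y hy
      rw [mem_closedBall, dist_eq_norm, nrm, inner_sub_left, xi, abs_le]
      have := ub y hy
      have := lb y hy
      constructor <;> linarith
    have h1 := measure_mono (μ := volume) hsub
    rw [hv, Measure.addHaar_closedBall _ _ (by norm_num), Measure.addHaar_closedBall _ _ (by linarith)] at h1
    have hb0 : volume (ball (0 : EuclideanSpace ℝ (Fin 1)) 1) ≠ 0 := (measure_ball_pos _ _ (by norm_num)).ne'
    have hb1 : volume (ball (0 : EuclideanSpace ℝ (Fin 1)) 1) ≠ ∞ := measure_ball_lt_top.ne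
    have h2 := (ENNReal.mul_le_mul_iff_left hb0 hb1).1 h1
    simpa using h2
  refine ⟨x, ?_, ?_⟩
  · rw [mem_interior]
    refine ⟨ball x ((a+b)/2), ?_, isOpen_ball, mem_ball_self (by linarith)⟩
    intro y hy
    rw [mem_ball, dist_eq_norm, nrm, inner_sub_left, xi, abs_lt] at hy
    have hpr := rep p
    have hqr := rep q
    rw [hpa] at hpr
    rw [show ⟪q, u0⟫ = -b by linarith] at hqr
    have hy2 : y = ((⟪y, u0⟫ + b) / (a + b)) • p + ((a - ⟪y, u0⟫) / (a + b)) • q := by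
      rw [hpr, hqr, smul_smul, smul_smul, ← add_smul]
      conv_lhs => rw [rep y]
      congr 1
      field_simp
      ring
    rw [hy2]
    refine hconv hp hq (div_nonneg (by linarith) hab.le) (div_nonneg (by linarith) hab.le) ?_
    field_simp
    ring
  · intro u hu
    have h1 := nrm u
    rw [hu] at h1
    have h2 := rep u
    rcases abs_eq (zero_le_one) |>.1 h1.symm with h | h
    · rw [h, one_smul] at h2
      rw [h2, xi]
      linarith
    · rw [h, neg_smul, one_smul] at h2
      rw [h2, inner_neg_right, xi]
      linarith

lemma exists_good (hn : 1 ≤ n) (hK : IsConvexBody K) (hvol : vol K = vol (unitBall n)) :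
    ∃ x ∈ interior K, ∫ u, (supp K u - ⟪x, (u : EuclideanSpace ℝ (Fin n))⟫) ^ (-2 : ℝ) ∂(sphMeasure n)
      ≤ (sphMeasure n univ).toReal := by
  have hv : volume K = volume (closedBall (0 : EuclideanSpace ℝ (Fin n)) 1) := 
    (ENNReal.toReal_eq_toReal_iff' hK.1.measure_lt_top.ne measure_closedBall_lt_top.ne).1 hvol
  rcases Nat.lt_or_ge 1 n with h2 | h1
  · obtain ⟨c, hc, h⟩ := bs_body hn hK hv
    refine ⟨c, hc, ?_⟩
    have pos : ∀ u : sphere (0 : EuclideanSpace ℝ (Fin n)) 1, 0 < supp K u - ⟪c, (u : EuclideanSpace ℝ (Fin n))⟫ :=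
      fun u => supp_pos hK.1 c hc u (sphere_ne u)
    have hi : Integrable (fun u : sphere (0 : EuclideanSpace ℝ (Fin n)) 1 =>
        (supp K u - ⟪c, (u : EuclideanSpace ℝ (Fin n))⟫)⁻¹ ^ n) (sphMeasure n) :=
      cont_int _ (((s_cont hK.1 c).inv₀ fun u => (pos u).ne').pow n)
    have hle : ∫ u, (supp K u - ⟪c, (u : EuclideanSpace ℝ (Fin n))⟫)⁻¹ ^ n ∂(sphMeasure n) ≤ (sphMeasure n univ).toReal := by
      rw [integral_eq_lintegral_of_nonneg_ae (ae_of_all _ fun u => by have := pos u; simp only [Pi.zero_apply]; positivity) hi.1]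
      exact ENNReal.toReal_mono (measure_ne_top _ _) h
    have nn : (2:ℝ) ≤ n := by exact_mod_cast h2
    have pw : ∀ u : sphere (0 : EuclideanSpace ℝ (Fin n)) 1, (supp K u - ⟪c, (u : EuclideanSpace ℝ (Fin n))⟫) ^ (-2 : ℝ) ≤
        (2 / n) * (supp K u - ⟪c, (u : EuclideanSpace ℝ (Fin n))⟫)⁻¹ ^ n + (1 - 2 / n) := by
      intro u
      have hp := pos u
      generalize supp K u - ⟪c, (u : EuclideanSpace ℝ (Fin n))⟫ = t at hp
      have ht : 0 < t⁻¹ := by positivity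
      have := Real.geom_mean_le_arith_mean2_weighted (w₁ := 2 / n) (w₂ := 1 - 2 / n) (p₁ := t⁻¹ ^ n) (p₂ := 1)
        (by positivity) (by rw [sub_nonneg, div_le_one (by positivity)]; exact nn) (by positivity) (by norm_num) (by ring)
      rw [Real.one_rpow, mul_one, mul_one, ← Real.rpow_natCast, ← Real.rpow_mul ht.le,
        mul_div_cancel₀ _ (by positivity), Real.inv_rpow hp.le, ← Real.rpow_neg hp.le, Real.rpow_natCast] at this
      exact this
    calc _ ≤ ∫ u, ((2 / n) * (supp K u - ⟪c, (u : EuclideanSpace ℝ (Fin n))⟫)⁻¹ ^ n + (1 - 2 / n)) ∂(sphMeasure n) :=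
          integral_mono (rpow_int hK.1 c hc _) ((hi.const_mul _).add (integrable_const _)) pw
      _ = (2 / n) * ∫ u, (supp K u - ⟪c, (u : EuclideanSpace ℝ (Fin n))⟫)⁻¹ ^ n ∂(sphMeasure n) + 
          (1 - 2 / n) * (sphMeasure n univ).toReal := by
          rw [integral_add (hi.const_mul _) (integrable_const _), integral_const_mul, integral_const, smul_eq_mul, mul_comm (1 - 2 / (n:ℝ))]
          rfl
      _ ≤ (2 / n) * (sphMeasure n univ).toReal + (1 - 2 / n) * (sphMeasure n univ).toReal := by
          gcongr
      _ = _ := by ring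
  · obtain rfl : n = 1 := by omega
    obtain ⟨x, hx, h⟩ := good_one K hK hv
    refine ⟨x, hx, ?_⟩
    calc _ ≤ ∫ u, (1:ℝ) ∂(sphMeasure 1) := by
          refine integral_mono (rpow_int hK.1 x hx _) (integrable_const _) fun u => ?_
          exact Real.rpow_le_one_of_one_le_of_nonpos (h u (by simp)) (by norm_num)
      _ = _ := by simp [Measure.real]
end

/-- `L²` closeness of `s_{-2}` to the constant `r`. -/
theorem statement7 (n : ℕ) (hn : 1 ≤ n) (ε : ℝ) (hε0 : 0 < ε) (hε1 : ε < 1)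
    (K : Set (EuclideanSpace ℝ (Fin n))) (hK : IsConvexBody K)
    (hvol : vol K = vol (unitBall n))
    (hent : entropyP (-1) K / (n * vol (unitBall n)) ≥ 1 - ε)
    (e₂ : EuclideanSpace ℝ (Fin n)) (he₂ : e₂ ∈ interior K)
    (he₂min : ∀ x ∈ interior K,
      (∫ u, (supp K u - ⟪e₂, (u : EuclideanSpace ℝ (Fin n))⟫) ^ (-2 : ℝ) ∂(sphMeasure n))
        ≤ ∫ u, (supp K u - ⟪x, (u : EuclideanSpace ℝ (Fin n))⟫) ^ (-2 : ℝ) ∂(sphMeasure n)) :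
    (∫ u, (supp K u - ⟪e₂, (u : EuclideanSpace ℝ (Fin n))⟫ - rConst K e₂) ^ 2
        ∂(sphMeasure n))
      ≤ 2 * n * vol (unitBall n) * Metric.diam K ^ 2 * ε := by
  have hcomp := hK.1
  have hneK := hK.2.2.mono interior_subset
  have pos : ∀ x ∈ interior K, ∀ u : sphere (0 : EuclideanSpace ℝ (Fin n)) 1,
      0 < supp K u - ⟪x, (u : EuclideanSpace ℝ (Fin n))⟫ :=
    fun x hx u => supp_pos hcomp x hx u (sphere_ne u)
  have hI2 : (∫ u, (supp K u - ⟪e₂, (u : EuclideanSpace ℝ (Fin n))⟫) ^ (-2 : ℝ) ∂(sphMeasure n)) ≤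
      (sphMeasure n univ).toReal := by
    obtain ⟨x, hx, h⟩ := exists_good hn hK hvol
    exact (he₂min x hx).trans h
  have hI1 : entropyP (-1) K ≤ ∫ u, (supp K u - ⟪e₂, (u : EuclideanSpace ℝ (Fin n))⟫) ^ (-1 : ℝ) ∂(sphMeasure n) := by
    refine csInf_le ⟨0, ?_⟩ ⟨e₂, he₂, rfl⟩
    rintro _ ⟨x, hx, rfl⟩
    exact integral_nonneg fun u => Real.rpow_nonneg (pos x hx u).le _
  have hωd := sph_mass (n := n)
  have hω : 0 < (n : ℝ) * vol (unitBall n) := by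
    have : 0 < vol (unitBall n) := 
      ENNReal.toReal_pos (measure_closedBall_pos _ _ (by norm_num)).ne' measure_closedBall_lt_top.ne
    have : (0:ℝ) < n := by exact_mod_cast hn
    positivity
  have i1 := rpow_int hcomp e₂ he₂ (-1)
  have i2 := rpow_int hcomp e₂ he₂ (-2)
  rw [ge_iff_le, le_div_iff₀ hω] at hent
  have hr : rConst K e₂ = (n * vol (unitBall n)) ^ ((1 : ℝ) / 2) / 
    (∫ u, (supp K u - ⟪e₂, (u : EuclideanSpace ℝ (Fin n))⟫) ^ (-2 : ℝ) ∂(sphMeasure n)) ^ ((1 : ℝ) / 2) := by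
    rw [← hωd]; rfl
  rw [hωd] at hI2
  set ω := (n : ℝ) * vol (unitBall n) with hωdef
  set I1 := ∫ u, (supp K u - ⟪e₂, (u : EuclideanSpace ℝ (Fin n))⟫) ^ (-1 : ℝ) ∂(sphMeasure n) with hI1d
  set I2 := ∫ u, (supp K u - ⟪e₂, (u : EuclideanSpace ℝ (Fin n))⟫) ^ (-2 : ℝ) ∂(sphMeasure n) with hI2d
  set r := rConst K e₂ with hrd
  set s : sphere (0 : EuclideanSpace ℝ (Fin n)) 1 → ℝ := fun u => supp K u - ⟪e₂, (u : EuclideanSpace ℝ (Fin n))⟫ with hs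
  have sp : ∀ u, 0 < s u := pos e₂ he₂
  have one_int : ∀ c : ℝ, ∫ u, c ∂(sphMeasure n) = c * ω := by
    intro c
    rw [integral_const, smul_eq_mul, ← hωd, mul_comm]; rfl
  have r2 : ∀ u, s u ^ (-2:ℝ) = (s u)⁻¹ ^ 2 := by
    intro u
    rw [Real.rpow_neg (sp u).le, inv_pow]; norm_cast
  have r1 : ∀ u, s u ^ (-1:ℝ) = (s u)⁻¹ := fun u => Real.rpow_neg_one _
  have quad : ∀ a b c : ℝ, ∫ u, (a - b * s u ^ (-1:ℝ) + c * s u ^ (-2:ℝ)) ∂(sphMeasure n) = a * ω - b * I1 + c * I2 := by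
    intro a b c
    have j1 : Integrable (fun u => b * s u ^ (-1:ℝ)) (sphMeasure n) := i1.const_mul b
    have j2 : Integrable (fun u => c * s u ^ (-2:ℝ)) (sphMeasure n) := i2.const_mul c
    have j3 : Integrable (fun u => a - b * s u ^ (-1:ℝ)) (sphMeasure n) := (integrable_const a).sub j1
    rw [integral_add j3 j2, integral_sub (integrable_const a) j1, integral_const_mul, integral_const_mul, one_int]
  have I1pos : 0 < I1 := by nlinarith
  have I2pos : 0 < I2 := by
    have h1 := quad ((I1 / ω) ^ 2) (2 * (I1 / ω)) 1
    have h2 : 0 ≤ ∫ u, ((I1 / ω) ^ 2 - 2 * (I1 / ω) * s u ^ (-1:ℝ) + 1 * s u ^ (-2:ℝ)) ∂(sphMeasure n) := by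
      refine integral_nonneg fun u => ?_
      simp only [Pi.zero_apply]
      rw [r1, r2]
      nlinarith [sq_nonneg (I1 / ω - (s u)⁻¹)]
    rw [h1] at h2
    have h3 : (I1 / ω) ^ 2 * ω = I1 ^ 2 / ω := by field_simp
    have h4 : 2 * (I1 / ω) * I1 = 2 * (I1 ^ 2 / ω) := by ring
    have h5 : 0 < I1 ^ 2 / ω := by positivity
    rw [h3, h4] at h2
    linarith
  have r0 : 1 ≤ r := by
    rw [hr, one_le_div (by positivity)]
    exact Real.rpow_le_rpow I2pos.le hI2 (by norm_num)
  have rsq : r ^ 2 * I2 = ω := by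
    rw [hr, div_pow, ← Real.rpow_natCast, ← Real.rpow_natCast, ← Real.rpow_mul hω.le, ← Real.rpow_mul I2pos.le]
    norm_num
    field_simp
  have sD : ∀ u, s u ≤ diam K := by
    intro u
    obtain ⟨y, hy, h⟩ := supp_att hcomp hneK (u : EuclideanSpace ℝ (Fin n))
    have hu : ‖(u : EuclideanSpace ℝ (Fin n))‖ = 1 := by simp
    calc s u = ⟪y - e₂, (u : EuclideanSpace ℝ (Fin n))⟫ := by simp only [hs]; rw [← h, inner_sub_left]
      _ ≤ ‖y - e₂‖ * ‖(u : EuclideanSpace ℝ (Fin n))‖ := real_inner_le_norm _ _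
      _ = dist y e₂ := by rw [hu, mul_one, dist_eq_norm]
      _ ≤ _ := dist_le_diam_of_mem hcomp.isBounded hy (interior_subset he₂)
  have pw : ∀ u, (s u - r) ^ 2 ≤ diam K ^ 2 - (diam K ^ 2 * (2 * r)) * s u ^ (-1:ℝ) + (diam K ^ 2 * r ^ 2) * s u ^ (-2:ℝ) := by
    intro u
    rw [r1, r2]
    have h1 : (s u - r) ^ 2 = s u ^ 2 * (1 - r * (s u)⁻¹) ^ 2 := by
      have := sp u
      field_simp
    have h2 : s u ^ 2 ≤ diam K ^ 2 := pow_le_pow_left₀ (sp u).le (sD u) 2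
    calc _ = _ := h1
      _ ≤ diam K ^ 2 * (1 - r * (s u)⁻¹) ^ 2 := mul_le_mul_of_nonneg_right h2 (sq_nonneg _)
      _ = _ := by ring
  have fin : ∫ u, (s u - r) ^ 2 ∂(sphMeasure n) ≤ 
      diam K ^ 2 * ω - (diam K ^ 2 * (2 * r)) * I1 + (diam K ^ 2 * r ^ 2) * I2 := by
    rw [← quad]
    refine integral_mono (cont_int _ (((s_cont hcomp e₂).sub continuous_const).pow 2)) 
      (((integrable_const _).sub (i1.const_mul _)).add (i2.const_mul _)) pw
  refine fin.trans ?_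
  have e1 : diam K ^ 2 * ω - (diam K ^ 2 * (2 * r)) * I1 + (diam K ^ 2 * r ^ 2) * I2 =
      diam K ^ 2 * (2 * (ω - r * I1)) := by
    rw [mul_assoc (diam K ^ 2) (r^2) I2, rsq]; ring
  rw [e1, show 2 * n * vol (unitBall n) * diam K ^ 2 * ε = diam K ^ 2 * (2 * (ω * ε)) by rw [hωdef]; ring]
  refine mul_le_mul_of_nonneg_left ?_ (sq_nonneg _)
  have : I1 ≤ r * I1 := le_mul_of_one_le_left I1pos.le r0
  nlinarith
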